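/- For all n ≥ 1 and k ≥ 1, the following four sums are equal in ℤ[x_1, …, x_k]: Σ_{Υ ∈ Nor_n} e_{λ^{Lyn}(Υ)}(x_1,…,x_k) = Σ_{θ ∈ Q_{n−1}} e_{λ^{AA}(θ)}(x_1,…,x_k) = Σ_{θ ∈ Q_{n−1}} e_{λ^{TN}(θ)}(x_1,…,x_k) = Σ_{Υ ∈ Nor_n} e_{λ^{Comb}(Υ)}(x_1,…,x_k). -/

import Mathlib

/-! Colored labeled binary trees.  Leaf labels are positive integers; colors are
natural numbers (the paper's color set ℙ = {1,2,…} is identified with ℕ via j ↦ j-1,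
i.e. color index `i : ℕ` represents the paper's color `i+1`). -/

inductive CTree : Type
  | leaf (label : ℕ) : CTree
  | node (color : ℕ) (l r : CTree) : CTree
deriving DecidableEq

namespace CTree

/-- leaf labels from left to right -/
def leavesList : CTree → List ℕ
  | leaf m => [m]
  | node _ l r => leavesList l ++ leavesList r

/-- the valency `v(x)`: smallest leaf label of the subtree -/
def minLeaf : CTree → ℕ
  | leaf m => m
  | node _ l r => min (minLeaf l) (minLeaf r)

/-- a tree is normalized if in every subtree the leftmost leaf carries the
smallest leaf label of the subtree. -/
def Normalized : CTree → Prop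
  | leaf _ => True
  | node _ l r => Normalized l ∧ Normalized r ∧ minLeaf l < minLeaf r

/-- number of internal nodes with color `j` -/
def colorCount : CTree → ℕ → ℕ
  | leaf _, _ => 0
  | node c l r, j => (if c = j then 1 else 0) + colorCount l j + colorCount r j

def isLeafB : CTree → Bool
  | leaf _ => true
  | node _ _ _ => false

def left : CTree → CTree
  | leaf m => leaf m
  | node _ l _ => l

def right : CTree → CTree
  | leaf m => leaf m
  | node _ _ r => r

def rootColor : CTree → ℕ
  | leaf _ => 0
  | node c _ _ => c

/-- the root of `T` is a Lyndon node: either the left child is a leaf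
or `v(R(L(x))) > v(R(x))`. (Leaves count as Lyndon.) -/
def RootLyndonB (T : CTree) : Bool :=
  isLeafB T || isLeafB (left T) || decide (minLeaf (right T) < minLeaf (right (left T)))

/-- colored Lyndon condition: every internal node that is not a Lyndon node
satisfies `color(L(x)) > color(x)` -/
def LynColored : CTree → Prop
  | leaf _ => True
  | node c l r => LynColored l ∧ LynColored r ∧
      (RootLyndonB (node c l r) = true ∨ c < rootColor l)

/-- colored comb condition: every internal node whose right child is internal
satisfies `color(x) > color(R(x))` -/
def CombColored : CTree → Prop
  | leaf _ => True
  | node c l r => CombColored l ∧ CombColored r ∧ (isLeafB r = true ∨ rootColor r < c)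

/-- all colors equal to `0`: an (essentially) uncolored tree. -/
def Mono : CTree → Prop
  | leaf _ => True
  | node c l r => c = 0 ∧ Mono l ∧ Mono r

/-- the tree has leaf label set `[n] = {1,…,n}` (each label once) -/
def OnSet (n : ℕ) (T : CTree) : Prop := T.leavesList.Perm ((List.range n).map (· + 1))

/-- `lynAux T = (b, m)`: `b` is the size of the block of `π^{Lyn}` containing the
root (`0` for a leaf) and `m` is the multiset of sizes of the other blocks. -/
def lynAux : CTree → ℕ × Multiset ℕ
  | leaf _ => (0, 0)
  | node c l r =>
    let bl := (lynAux l).1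
    let ml := (lynAux l).2
    let br := (lynAux r).1
    let mr := (lynAux r).2
    let closedR := mr + (if br = 0 then 0 else {br})
    if RootLyndonB (node c l r) then
      (1, ml + (if bl = 0 then 0 else {bl}) + closedR)
    else (1 + bl, ml + closedR)

/-- the Lyndon type `λ^{Lyn}`: multiset of block sizes of `π^{Lyn}` -/
def lynType (T : CTree) : Multiset ℕ :=
  (if (lynAux T).1 = 0 then (0 : Multiset ℕ) else {(lynAux T).1}) + (lynAux T).2

def combAux : CTree → ℕ × Multiset ℕ
  | leaf _ => (0, 0)
  | node _ l r =>
    let bl := (combAux l).1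
    let ml := (combAux l).2
    let br := (combAux r).1
    let mr := (combAux r).2
    (1 + br, ml + mr + (if bl = 0 then 0 else {bl}))

/-- the comb type `λ^{Comb}`: multiset of block sizes of `π^{Comb}` -/
def combType (T : CTree) : Multiset ℕ :=
  (if (combAux T).1 = 0 then (0 : Multiset ℕ) else {(combAux T).1}) + (combAux T).2

/-- subtrees (= nodes) of a tree -/
def subtreesC : CTree → List CTree
  | leaf m => [leaf m]
  | node c l r => node c l r :: (subtreesC l ++ subtreesC r)

end CTree

/-- normalized uncolored labeled binary trees on `[n]`: the set `Nor_n`. -/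
def NorSet (n : ℕ) : Set CTree :=
  {T | T.OnSet n ∧ T.Normalized ∧ T.Mono}

/-- `Lyn_μ` for a weak composition `μ` (indexed by ℕ; `μ i` is the number of
internal nodes of color `i`). -/
def LynSet (n : ℕ) (μ : ℕ →₀ ℕ) : Set CTree :=
  {T | T.OnSet n ∧ T.Normalized ∧ T.LynColored ∧ ∀ j, T.colorCount j = μ j}

/-- `Comb_μ` -/
def CombSet (n : ℕ) (μ : ℕ →₀ ℕ) : Set CTree :=
  {T | T.OnSet n ∧ T.Normalized ∧ T.CombColored ∧ ∀ j, T.colorCount j = μ j}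

/-- `Lyn_μ` for `μ ∈ wcomp` with support in `[k]`, given as `f : Fin k → ℕ`. -/
def LynSetF (n k : ℕ) (f : Fin k → ℕ) : Set CTree :=
  {T | T.OnSet n ∧ T.Normalized ∧ T.LynColored ∧
    ∀ j : ℕ, T.colorCount j = if h : j < k then f ⟨j, h⟩ else 0}

def CombSetF (n k : ℕ) (f : Fin k → ℕ) : Set CTree :=
  {T | T.OnSet n ∧ T.Normalized ∧ T.CombColored ∧
    ∀ j : ℕ, T.colorCount j = if h : j < k then f ⟨j, h⟩ else 0}

/-! Stirling permutations, as lists of natural numbers. -/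

/-- `w` is a Stirling permutation on the finite set `A` of positive integers:
every letter of `A` occurs exactly twice, no other letter occurs, and every
letter lying strictly between the two occurrences of a letter `a` is larger
than `a`. -/
def IsStirling (A : Finset ℕ) (w : List ℕ) : Prop :=
  (∀ a, w.count a = if a ∈ A then 2 else 0) ∧
  (∀ a b : ℕ, ∀ i l j : ℕ, i < l → l < j → w[i]? = some a → w[j]? = some a →
      w[l]? = some b → a < b)

/-- the set `Q_A` of Stirling permutations on `A` -/
def QSetA (A : Finset ℕ) : Set (List ℕ) := {w | IsStirling A w}

/-- the set `Q_m` of Stirling permutations on `[m]` -/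
def QSet (m : ℕ) : Set (List ℕ) := QSetA (Finset.Icc 1 m)

/-- `(a,b)` is an ascending adjacent pair of `w`: `a < b` and the second
occurrence of `a` immediately precedes the first occurrence of `b`. -/
def AApair (w : List ℕ) (a b : ℕ) : Prop :=
  a < b ∧ ∃ i, w[i]? = some a ∧ w[i+1]? = some b ∧
    (w.take (i+1)).count a = 2 ∧ (w.take (i+1)).count b = 0

/-- `(a,b)` is a terminally nested pair of `w`: `a < b` and the second
occurrence of `a` immediately follows the second occurrence of `b`. -/
def TNpair (w : List ℕ) (a b : ℕ) : Prop :=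
  a < b ∧ ∃ i, w[i]? = some b ∧ w[i+1]? = some a ∧
    (w.take (i+1)).count b = 2 ∧ (w.take (i+2)).count a = 2

-- Given a relation `R` on letters which is a partial matching (as `AApair w`
-- and `TNpair w` are), the multiset of sizes of the blocks of the partition of `A`
-- generated by `R`, i.e. the multiset of lengths of the maximal `R`-chains.
-- This gives the types `λ^{AA}` and `λ^{TN}` of a Stirling permutation.
open Classical in
noncomputable def chainType (A : Finset ℕ) (R : ℕ → ℕ → Prop) : Multiset ℕ :=
  ((A.image fun a => A.filter fun b => Relation.EqvGen R a b).val.map Finset.card)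

/-- splits off the first block `a τ a` of a Stirling permutation. -/
def blockSplit (w : List ℕ) : List ℕ × List ℕ :=
  match w with
  | [] => ([], [])
  | a :: rest =>
    let i := rest.findIdx (· = a)
    (a :: rest.take (i+1), rest.drop (i+1))

/-- block factorization of a Stirling permutation (with fuel). -/
def toBlocksAux : ℕ → List ℕ → List (List ℕ)
  | 0, _ => []
  | _+1, [] => []
  | f+1, w => (blockSplit w).1 :: toBlocksAux f (blockSplit w).2

def toBlocks (w : List ℕ) : List (List ℕ) := toBlocksAux w.length w

/-- splits a list of blocks at the first descent of the leading letters: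
this gives the ascending adjacent factorization `θ = θ¹θ²`. -/
def splitAtDescent : List (List ℕ) → Option (List (List ℕ) × List (List ℕ))
  | [] => none
  | [_] => none
  | b :: b' :: rest =>
    if b'.headD 0 < b.headD 0 then some ([b], b' :: rest)
    else (splitAtDescent (b' :: rest)).map fun p => (b :: p.1, p.2)

/-- the bijection `ξ : Q_A → Q_A` (with fuel).  On an irreducible AA-word
`a₁τ₁a₁ a₂τ₂a₂ ⋯ a_kτ_ka_k` it returns
`a₁ξ(τ₁) a₂ξ(τ₂) ⋯ a_{k-1}ξ(τ_{k-1}) a_k a_k a_{k-1} ⋯ a₂ a₁ ξ(τ_k)`, and it is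
multiplicative on the complete ascending adjacent factorization. -/
def xiAux : ℕ → List ℕ → List ℕ
  | 0, w => w
  | f+1, w =>
    let bs := toBlocks w
    match splitAtDescent bs with
    | some p => xiAux f p.1.flatten ++ xiAux f p.2.flatten
    | none =>
      match bs with
      | [] => []
      | _ =>
        let heads := bs.map fun b => b.headD 0
        let inners := bs.map fun b => (b.drop 1).dropLast
        (List.zipWith (fun a τ => a :: xiAux f τ) heads.dropLast inners.dropLast).flatten
          ++ (heads.getLastD 0 :: heads.reverse) ++ xiAux f (inners.getLastD [])

def xiMap (w : List ℕ) : List ℕ := xiAux (w.length + 1) w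

/-- the subword of first occurrences of the letters of `w` (with fuel). -/
def initAux : ℕ → List ℕ → List ℕ
  | 0, _ => []
  | _+1, [] => []
  | f+1, a :: rest => a :: initAux f (rest.filter (· ≠ a))

/-- the initial permutation `init(θ)` -/
def initPerm (w : List ℕ) : List ℕ := initAux w.length w

open MvPolynomial

/-- the elementary symmetric polynomial `e_m(x_1,…,x_k)` over ℤ -/
noncomputable def epoly (k m : ℕ) : MvPolynomial (Fin k) ℤ :=
  ∑ S ∈ Finset.powersetCard m (Finset.univ : Finset (Fin k)), ∏ i ∈ S, X i

/-- `e_λ = e_{λ₁} ⋯ e_{λ_r}` for an integer partition `λ` given as a multiset -/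
noncomputable def eprod (k : ℕ) (lam : Multiset ℕ) : MvPolynomial (Fin k) ℤ :=
  (lam.map (epoly k)).prod

/-- the ascending adjacent type `λ^{AA}(θ)` -/
noncomputable def aaType (m : ℕ) (w : List ℕ) : Multiset ℕ :=
  chainType (Finset.Icc 1 m) (AApair w)

/-- the terminally nested type `λ^{TN}(θ)` -/
noncomputable def tnType (m : ℕ) (w : List ℕ) : Multiset ℕ :=
  chainType (Finset.Icc 1 m) (TNpair w)


/-! ### The common recursion on types -/

namespace FourTypes

section Abstract

variable {M : Type} [AddCommMonoid M]

/-- the multiset `{b}`, or empty when `b = 0` -/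
def cl (b : ℕ) : Multiset ℕ := if b = 0 then 0 else {b}

theorem cl_zero : cl 0 = 0 := rfl

theorem cl_pos {b : ℕ} (h : b ≠ 0) : cl b = {b} := by simp [cl, h]

theorem cl_sum (b : ℕ) : (cl b).sum = b := by
  unfold cl; split <;> simp_all

/-- sum over all splittings of a part -/
def S (F : Multiset ℕ → M) (lam : Multiset ℕ) : M :=
  (lam.map fun b => ∑ i ∈ Finset.range b, F (lam.erase b + cl (b - 1 - i) + {i + 2})).sum

/-- sum of `F` over all types obtained by inserting a new maximal element -/
def Phi (F : Multiset ℕ → M) (lam : Multiset ℕ) : M :=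
  S F lam + (lam.sum + 1) • F (lam + {1})

/-- the iterated recursion -/
def Psi : ℕ → (Multiset ℕ → M) → M
  | 0, F => F 0
  | m + 1, F => Psi m (Phi F)

theorem S_zero (F : Multiset ℕ → M) : S F 0 = 0 := by simp [S]

theorem S_add (F : Multiset ℕ → M) (lam mu : Multiset ℕ) :
    S F (lam + mu) = S (fun x => F (x + mu)) lam + S (fun x => F (lam + x)) mu := by
  unfold S
  rw [Multiset.map_add, Multiset.sum_add]
  congr 1
  · congr 1
    apply Multiset.map_congr rfl
    intro b hb
    apply Finset.sum_congr rfl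
    intro i _
    rw [Multiset.erase_add_left_pos _ hb]
    congr 1
    abel
  · congr 1
    apply Multiset.map_congr rfl
    intro b hb
    apply Finset.sum_congr rfl
    intro i _
    rw [Multiset.erase_add_right_pos _ hb]
    congr 1
    abel

theorem S_cl (F : Multiset ℕ → M) (b : ℕ) :
    S F (cl b) = ∑ i ∈ Finset.range b, F (cl (b - 1 - i) + {i + 2}) := by
  by_cases h : b = 0
  · subst h; simp [S, cl]
  · simp [S, cl_pos h]

theorem S_congr {F G : Multiset ℕ → M} (h : ∀ x, F x = G x) (lam : Multiset ℕ) :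
    S F lam = S G lam := by
  have : F = G := funext h
  rw [this]

end Abstract

/-! ### Trees -/

open CTree

/-- all insertions of a new leaf `n` strictly below the root edge / anywhere -/
def insAll (n : ℕ) : CTree → List CTree
  | leaf m => [node 0 (leaf m) (leaf n)]
  | node c l r => node 0 (node c l r) (leaf n) ::
      ((insAll n l).map (fun l' => node c l' r) ++ (insAll n r).map (fun r' => node c l r'))

/-- insertions not at the root -/
def insIn (n : ℕ) : CTree → List CTree
  | leaf _ => []
  | node c l r =>
      (insAll n l).map (fun l' => node c l' r) ++ (insAll n r).map (fun r' => node c l r')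

theorem insAll_eq (n : ℕ) (T : CTree) : insAll n T = node 0 T (leaf n) :: insIn n T := by
  cases T <;> rfl

section Types

variable {M : Type} [AddCommMonoid M]

theorem comb_aux (n : ℕ) (T : CTree) : ∀ (H : ℕ → Multiset ℕ → M),
    ((insAll n T).map (fun T' => H (combAux T').1 (combAux T').2)).sum =
      H 1 ((combAux T).2 + cl (combAux T).1) +
      (∑ i ∈ Finset.range (combAux T).1,
        H (i + 2) ((combAux T).2 + cl ((combAux T).1 - 1 - i))) +
      S (H (combAux T).1) (combAux T).2 +
      ((combAux T).1 + (combAux T).2.sum) • H (combAux T).1 ((combAux T).2 + {1}) := by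
  induction T with
  | leaf m => intro H; simp [insAll, combAux, S, cl]
  | node c l r ihl ihr =>
    intro H
    obtain ⟨bl, ml, hl⟩ : ∃ b m, combAux l = (b, m) := ⟨_, _, rfl⟩
    obtain ⟨br, mr, hr⟩ : ∃ b m, combAux r = (b, m) := ⟨_, _, rfl⟩
    have hT : combAux (node c l r) = (1 + br, ml + mr + cl bl) := by
      simp [combAux, hl, hr, cl]
    have e1 : ∀ T', H (combAux (node c T' r)).1 (combAux (node c T' r)).2 =
        (fun b m => H (1 + br) (m + mr + cl b)) (combAux T').1 (combAux T').2 := by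
      intro T'; simp [combAux, hr, cl]
    have e2 : ∀ T', H (combAux (node c l T')).1 (combAux (node c l T')).2 =
        (fun b m => H (1 + b) (ml + m + cl bl)) (combAux T').1 (combAux T').2 := by
      intro T'; simp [combAux, hl, cl]
    have e0 : combAux (node 0 (node c l r) (leaf n)) = (1, ml + mr + cl bl + cl (1 + br)) := by
      rw [combAux, hT]; simp [combAux, cl]
    rw [insAll, List.map_cons, List.map_append, List.map_map, List.map_map, List.sum_cons,
      List.sum_append]
    simp only [Function.comp_def, e1, e2, e0, hT]
    rw [ihl (fun b m => H (1 + br) (m + mr + cl b)), ihr (fun b m => H (1 + b) (ml + m + cl bl))]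
    simp only [hl, hr]
    rw [S_add, S_add, S_cl, add_comm 1 br, Finset.sum_range_succ']
    have r1 : ∀ i, br + 1 - 1 - (i + 1) = br - 1 - i := by intro i; omega
    have r2 : br + 1 - 1 - 0 = br := by omega
    simp only [r1, r2]
    simp only [Multiset.sum_add, cl_sum]
    have a1 : ml + cl bl + mr + ({1} : Multiset ℕ) = ml + mr + cl bl + {1} := by abel
    have a2 : ml + ({1} : Multiset ℕ) + mr + cl bl = ml + mr + cl bl + {1} := by abel
    have a3 : ml + (mr + ({1} : Multiset ℕ)) + cl bl = ml + mr + cl bl + {1} := by abel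
    have a4 : ml + (mr + cl br) + cl bl = ml + mr + cl bl + cl br := by abel
    have a5 : ∀ x : Multiset ℕ, ml + (mr + x) + cl bl = ml + mr + cl bl + x := by intro x; abel
    have a6 : ml + mr + cl 1 + cl bl = ml + mr + cl bl + {1} := by
      rw [cl_pos one_ne_zero]; abel
    have a7 : ∀ i, ml + cl (bl - 1 - i) + mr + cl (i + 2)
        = ml + mr + (cl (bl - 1 - i) + {i + 2}) := by
      intro i; rw [cl_pos (by omega : i + 2 ≠ 0)]; abel
    have a8 : ml + cl bl + mr + cl 1 = ml + mr + cl bl + {1} := by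
      rw [cl_pos one_ne_zero]; abel
    have a9 : ∀ i, 1 + (i + 2) = i + 1 + 2 := by intro i; omega
    have a10 : br + 1 + (ml.sum + mr.sum + bl) = (bl + ml.sum) + (br + mr.sum) + 1 := by omega
    simp only [a2, a5, a7, a8, a9, a10]
    simp only [add_smul, one_smul]
    norm_num
    abel

theorem comb_ins (n : ℕ) (T : CTree) (F : Multiset ℕ → M) :
    ((insAll n T).map (fun T' => F (combType T'))).sum = Phi F (combType T) := by
  have e : ∀ T, combType T = cl (combAux T).1 + (combAux T).2 := fun T => rfl
  simp only [e]
  rw [comb_aux n T (fun b m => F (cl b + m)), Phi, S_add, S_cl, Multiset.sum_add, cl_sum]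
  have a0 : ∀ x : Multiset ℕ, cl 1 + (x + cl (combAux T).1) = cl (combAux T).1 + x + {1} := by
    intro x; rw [cl_pos one_ne_zero]; abel
  have a1 : ∀ i (x y : Multiset ℕ), cl (i + 2) + (x + y) = y + {i + 2} + x := by
    intro i x y; rw [cl_pos (by omega : i + 2 ≠ 0)]; abel
  simp only [a0, a1, add_assoc, add_smul, one_smul]
  abel

theorem rootLyn_node (c : ℕ) (l r : CTree) : RootLyndonB (node c l r) =
    (isLeafB l || decide (minLeaf r < minLeaf (right l))) := rfl

theorem lynAux_zero (T : CTree) : isLeafB T = true → lynAux T = (0, 0) := by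
  cases T <;> simp [isLeafB, lynAux]

theorem lynAux_ne (T : CTree) : isLeafB T = false → (lynAux T).1 ≠ 0 := by
  cases T with
  | leaf => simp [isLeafB]
  | node c l r => intro _; simp only [lynAux]; split <;> simp

theorem minLeaf_mem (T : CTree) : minLeaf T ∈ leavesList T := by
  induction T with
  | leaf m => simp [minLeaf, leavesList]
  | node c l r hl hr =>
    simp only [minLeaf, leavesList, List.mem_append]
    rcases min_choice (minLeaf l) (minLeaf r) with h | h <;> rw [h] <;> simp [hl, hr]

theorem minLeaf_le (T : CTree) : ∀ x ∈ leavesList T, minLeaf T ≤ x := by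
  induction T with
  | leaf m => simp [minLeaf, leavesList]
  | node c l r hl hr =>
    simp only [minLeaf, leavesList, List.mem_append]
    rintro x (h | h)
    · exact (min_le_left _ _).trans (hl x h)
    · exact (min_le_right _ _).trans (hr x h)

theorem insAll_minLeaf (n : ℕ) (T : CTree) (hT : ∀ x ∈ leavesList T, x < n) :
    ∀ T' ∈ insAll n T, minLeaf T' = minLeaf T := by
  induction T with
  | leaf m =>
    simp only [leavesList, List.mem_singleton, forall_eq] at hT
    simp [insAll, minLeaf, hT.le]
  | node c l r hl hr =>
    have h0 := hT _ (minLeaf_mem _)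
    simp only [leavesList, List.mem_append] at hT
    have hl' := hl (fun x hx => hT x (Or.inl hx))
    have hr' := hr (fun x hx => hT x (Or.inr hx))
    intro T' h
    simp only [insAll, List.mem_cons, List.mem_append, List.mem_map] at h
    rcases h with rfl | ⟨l', h, rfl⟩ | ⟨r', h, rfl⟩
    · rw [minLeaf]
      exact min_eq_left (by simpa [minLeaf] using h0.le)
    · simp [minLeaf, hl' _ h]
    · simp [minLeaf, hr' _ h]

theorem insAll_isLeaf (n : ℕ) (T : CTree) : ∀ T' ∈ insAll n T, isLeafB T' = false := by
  cases T with
  | leaf m => simp [insAll, isLeafB]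
  | node c l r =>
    intro T' h
    simp only [insAll, List.mem_cons, List.mem_append, List.mem_map] at h
    rcases h with rfl | ⟨l', h, rfl⟩ | ⟨r', h, rfl⟩ <;> rfl

theorem insIn_right (n : ℕ) (T : CTree) (hT : ∀ x ∈ leavesList T, x < n) :
    ∀ T' ∈ insIn n T, minLeaf (right T') = minLeaf (right T) ∧ isLeafB T' = isLeafB T := by
  cases T with
  | leaf m => simp [insIn]
  | node c l r =>
    simp only [leavesList, List.mem_append] at hT
    intro T' h
    simp only [insIn, List.mem_append, List.mem_map] at h
    rcases h with ⟨l', h, rfl⟩ | ⟨r', h, rfl⟩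
    · exact ⟨rfl, rfl⟩
    · exact ⟨insAll_minLeaf n r (fun x hx => hT x (Or.inr hx)) _ h, rfl⟩

theorem lynAux_node (c : ℕ) (l r : CTree) : lynAux (node c l r) =
    if RootLyndonB (node c l r) then (1, lynType l + lynType r)
    else (1 + (lynAux l).1, (lynAux l).2 + lynType r) := by
  rw [lynAux]
  simp only [lynType]
  split
  · congr 1; abel
  · congr 2; abel

theorem map_sum_congr {α : Type} {L : List α} {f g : α → M} (h : ∀ x ∈ L, f x = g x) :
    (L.map f).sum = (L.map g).sum := by
  rw [List.map_congr_left h]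

/-- the statement for full insertion, deduced from that for non-root insertion -/
theorem lyn_full (n : ℕ) (T : CTree) (hT : ∀ x ∈ leavesList T, x < n)
    (ih : ∀ (H : ℕ → Multiset ℕ → M),
      ((insIn n T).map (fun T' => H (lynAux T').1 (lynAux T').2)).sum =
      (∑ i ∈ Finset.range ((lynAux T).1 - 1),
        H (i + 1) ((lynAux T).2 + {(lynAux T).1 - i})) +
      S (H (lynAux T).1) (lynAux T).2 +
      (if (lynAux T).1 = 0 then 0 else ((lynAux T).1 + (lynAux T).2.sum + 1)) •
        H (lynAux T).1 ((lynAux T).2 + {1})) (F : Multiset ℕ → M) :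
    ((insAll n T).map (fun T' => F (lynType T'))).sum = Phi F (lynType T) := by
  have e : ∀ T, lynType T = cl (lynAux T).1 + (lynAux T).2 := fun T => rfl
  have e2 : (fun T' => F (lynType T')) =
    (fun T' => (fun b m => F (cl b + m)) (lynAux T').1 (lynAux T').2) := rfl
  rw [insAll_eq, List.map_cons, List.sum_cons, e2, ih (fun b m => F (cl b + m))]
  cases hleaf : isLeafB T with
  | true =>
    have hR : RootLyndonB (node 0 T (leaf n)) = true := by simp [rootLyn_node, hleaf]
    have hz := lynAux_zero T hleaf
    have hl : lynAux (leaf n) = (0, 0) := rfl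
    simp [lynAux_node, hR, e, hz, hl, cl, Phi, S_zero]
  | false =>
    have hR : RootLyndonB (node 0 T (leaf n)) = false := by
      have hx : minLeaf (right T) < n := by
        apply hT
        cases T with
        | leaf => simp [isLeafB] at hleaf
        | node c l r => simp [right, leavesList, minLeaf_mem]
      rw [rootLyn_node, hleaf]
      exact decide_eq_false hx.not_gt
    have hb := lynAux_ne T hleaf
    have hl : lynType (leaf n) = 0 := rfl
    rw [e (node 0 T (leaf n)), lynAux_node, hR, e T]
    obtain ⟨b, m, hbm⟩ : ∃ b m, lynAux T = (b, m) := ⟨_, _, rfl⟩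
    simp only [hbm] at hb ⊢
    obtain ⟨b, rfl⟩ := Nat.exists_eq_succ_of_ne_zero hb
    simp only [hl, Phi, S_add, S_cl, Multiset.sum_add, cl_sum]
    rw [if_neg (by simp), if_neg (by simp), Finset.sum_range_succ,
      ← Finset.sum_range_reflect (n := b)]
    have r1 : (b.succ - 1) = b := by omega
    have r2 : b - b = 0 := by omega
    have r3 : cl 0 = 0 := rfl
    simp only [r1, r2, r3]
    have s1 : ∀ i ∈ Finset.range b, F (cl (i + 1) + (m + {b.succ - i})) =
        F (cl (b - (b - 1 - i)) + {b - 1 - i + 2} + m) := by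
      intro i hi
      rw [Finset.mem_range] at hi
      have : b - (b - 1 - i) = i + 1 := by omega
      rw [this]
      have : b - 1 - i + 2 = b.succ - i := by omega
      rw [this]
      congr 1
      abel
    rw [Finset.sum_congr rfl s1]
    have s2 : cl (1 + b.succ) + (m + 0) = 0 + {b + 2} + m := by
      rw [cl_pos (by omega)]
      have : 1 + b.succ = b + 2 := by omega
      rw [this]; abel
    rw [s2]
    simp only [add_assoc]
    abel

theorem lyn_aux (n : ℕ) (T : CTree) (hT : ∀ x ∈ leavesList T, x < n) :
    ∀ (H : ℕ → Multiset ℕ → M),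
      ((insIn n T).map (fun T' => H (lynAux T').1 (lynAux T').2)).sum =
      (∑ i ∈ Finset.range ((lynAux T).1 - 1),
        H (i + 1) ((lynAux T).2 + {(lynAux T).1 - i})) +
      S (H (lynAux T).1) (lynAux T).2 +
      (if (lynAux T).1 = 0 then 0 else ((lynAux T).1 + (lynAux T).2.sum + 1)) •
        H (lynAux T).1 ((lynAux T).2 + {1}) := by
  induction T with
  | leaf m => intro H; simp [insIn, lynAux, S]
  | node c l r ihl ihr =>
    intro H
    simp only [leavesList, List.mem_append] at hT
    have hTl : ∀ x ∈ leavesList l, x < n := fun x hx => hT x (Or.inl hx)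
    have hTr : ∀ x ∈ leavesList r, x < n := fun x hx => hT x (Or.inr hx)
    have fl := lyn_full n l hTl (ihl hTl)
    have fr := lyn_full n r hTr (ihr hTr)
    have mr : minLeaf r < n := hTr _ (minLeaf_mem r)
    rw [insIn, List.map_append, List.sum_append, List.map_map, List.map_map]
    have hRr : ∀ r' ∈ insAll n r, RootLyndonB (node c l r') = RootLyndonB (node c l r) := by
      intro r' hr'
      rw [rootLyn_node, rootLyn_node, insAll_minLeaf n r hTr r' hr']
    have hR0 : RootLyndonB (node c (node 0 l (leaf n)) r) = true := by
      simp [RootLyndonB, left, right, minLeaf, mr]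
    have hRl : ∀ l' ∈ insIn n l, RootLyndonB (node c l' r) = RootLyndonB (node c l r) := by
      intro l' hl'
      have := insIn_right n l hTl l' hl'
      rw [rootLyn_node, rootLyn_node, this.1, this.2]
    cases hRT : RootLyndonB (node c l r) with
    | true =>
      have A : ((insAll n r).map ((fun T' => H (lynAux T').1 (lynAux T').2) ∘
          fun r' => node c l r')).sum = Phi (fun x => H 1 (lynType l + x)) (lynType r) := by
        rw [← fr]
        apply map_sum_congr
        intro r' hr'
        simp [lynAux_node, hRr r' hr', hRT]
      have B : ((insAll n l).map ((fun T' => H (lynAux T').1 (lynAux T').2) ∘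
          fun l' => node c l' r)).sum = Phi (fun x => H 1 (x + lynType r)) (lynType l) := by
        rw [← fl]
        apply map_sum_congr
        intro l' hl'
        rw [insAll_eq, List.mem_cons] at hl'
        have : RootLyndonB (node c l' r) = true := by
          rcases hl' with rfl | hl'
          · exact hR0
          · rw [hRl _ hl', hRT]
        simp [lynAux_node, this]
      rw [A, B, lynAux_node, hRT]
      simp only [if_true, Phi, S_add, Multiset.sum_add]
      have a1 : lynType l + {1} + lynType r = lynType l + lynType r + {1} := by abel
      have a2 : lynType l + (lynType r + {1}) = lynType l + lynType r + {1} := by abel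
      simp only [a1, a2]
      simp [add_smul]
      abel
    | false =>
      have hlf : isLeafB l = false := by
        cases h : isLeafB l
        · rfl
        · simp [rootLyn_node, h] at hRT
      have hb := lynAux_ne l hlf
      have A : ((insAll n r).map ((fun T' => H (lynAux T').1 (lynAux T').2) ∘
          fun r' => node c l r')).sum =
          Phi (fun x => H (1 + (lynAux l).1) ((lynAux l).2 + x)) (lynType r) := by
        rw [← fr]
        apply map_sum_congr
        intro r' hr'
        simp [lynAux_node c, hRr r' hr', hRT]
      have B : ((insIn n l).map ((fun T' => H (lynAux T').1 (lynAux T').2) ∘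
          fun l' => node c l' r)).sum = ((insIn n l).map (fun T' =>
            (fun b m => H (1 + b) (m + lynType r)) (lynAux T').1 (lynAux T').2)).sum := by
        apply map_sum_congr
        intro l' hl'
        simp [lynAux_node c, hRl _ hl', hRT]
      have hR1 : RootLyndonB (node 0 l (leaf n)) = false := by
        have hx : minLeaf (right l) < n := by
          apply hTl
          cases l with
          | leaf => simp [isLeafB] at hlf
          | node c l r => simp [right, leavesList, minLeaf_mem]
        rw [rootLyn_node, hlf]
        exact decide_eq_false hx.not_gt
      have C : lynType (node 0 l (leaf n)) = cl (1 + (lynAux l).1) + (lynAux l).2 := by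
        have hl : lynType (leaf n) = 0 := rfl
        have e : ∀ T, lynType T = cl (lynAux T).1 + (lynAux T).2 := fun T => rfl
        rw [e, lynAux_node, hR1, hl]
        simp
      rw [A, insAll_eq, List.map_cons, List.sum_cons, B, ihl hTl (fun b m => H (1 + b) (m + lynType r))]
      simp only [Function.comp_apply]
      rw [lynAux_node c _ r, lynAux_node c l r, hRT, hR0, C]
      obtain ⟨b, m, hbm⟩ : ∃ b m, lynAux l = (b, m) := ⟨_, _, rfl⟩
      simp only [hbm] at hb ⊢
      obtain ⟨b, rfl⟩ := Nat.exists_eq_succ_of_ne_zero hb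
      have r0 : 1 + b.succ - 1 = b + 1 := by omega
      simp only [if_true, if_neg hb, Bool.false_eq_true, if_false, Phi, S_add, Multiset.sum_add,
        r0, Finset.sum_range_succ']
      have r1 : ∀ i, 1 + b.succ - (i + 1) = b.succ - i := by intro i; omega
      have r2 : b.succ - 1 = b := by omega
      have r3 : ∀ i, H (1 + (i + 1)) (m + lynType r + {b.succ - i}) =
          H (i + 1 + 1) (m + lynType r + {b.succ - i}) := by
        intro i; rw [add_comm 1 (i + 1)]
      have a1 : ∀ x : Multiset ℕ, m + x + lynType r = m + lynType r + x := by intro x; abel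
      have a2 : m + (lynType r + {1}) = m + lynType r + {1} := by abel
      have a3 : cl (1 + b.succ) + m + lynType r = m + lynType r + {1 + b.succ} := by
        rw [cl_pos (by omega)]; abel
      have r4 : 1 + b.succ ≠ 0 := by omega
      have r5 : 1 + b.succ + (m.sum + (lynType r).sum) + 1 =
        (b.succ + m.sum + 1) + ((lynType r).sum + 1) := by omega
      rw [if_neg r4, r5]
      simp only [a2, a3, r1, r2, a1, Nat.sub_zero, zero_add]
      simp only [r3, add_smul, one_smul]
      abel

theorem lyn_ins (n : ℕ) (T : CTree) (hT : ∀ x ∈ leavesList T, x < n) (F : Multiset ℕ → M) :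
    ((insAll n T).map (fun T' => F (lynType T'))).sum = Phi F (lynType T) :=
  lyn_full n T hT (lyn_aux n T hT) F

end Types

/-! ### Enumeration of normalized trees -/

theorem insAll_perm (n : ℕ) (T : CTree) :
    ∀ T' ∈ insAll n T, (leavesList T').Perm (n :: leavesList T) := by
  induction T with
  | leaf m =>
    intro T' h
    simp only [insAll, List.mem_singleton] at h
    subst h
    exact List.Perm.swap _ _ _
  | node c l r hl hr =>
    intro T' h
    simp only [insAll, List.mem_cons, List.mem_append, List.mem_map] at h
    rcases h with rfl | ⟨l', h, rfl⟩ | ⟨r', h, rfl⟩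
    · rw [leavesList]
      exact List.perm_append_singleton _ _
    · exact (hl l' h).append_right _
    · exact ((hr r' h).append_left _).trans List.perm_middle

theorem insAll_norm (n : ℕ) (T : CTree) (hT : ∀ x ∈ leavesList T, x < n) (hN : Normalized T)
    (hM : Mono T) : ∀ T' ∈ insAll n T, Normalized T' ∧ Mono T' := by
  induction T with
  | leaf m =>
    intro T' h
    simp only [insAll, List.mem_singleton] at h
    subst h
    simp only [leavesList, List.mem_singleton, forall_eq] at hT
    simp [Normalized, Mono, minLeaf, hT]
  | node c l r hl hr =>
    intro T' h
    have h0 := hT _ (minLeaf_mem _)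
    simp only [leavesList, List.mem_append] at hT
    have hTl : ∀ x ∈ leavesList l, x < n := fun x hx => hT x (Or.inl hx)
    have hTr : ∀ x ∈ leavesList r, x < n := fun x hx => hT x (Or.inr hx)
    simp only [insAll, List.mem_cons, List.mem_append, List.mem_map] at h
    rcases h with rfl | ⟨l', h, rfl⟩ | ⟨r', h, rfl⟩
    · exact ⟨⟨hN, trivial, h0⟩, rfl, hM, trivial⟩
    · have := hl hTl hN.1 hM.2.1 l' h
      exact ⟨⟨this.1, hN.2.1, by rw [insAll_minLeaf n l hTl l' h]; exact hN.2.2⟩,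
        hM.1, this.2, hM.2.2⟩
    · have := hr hTr hN.2.1 hM.2.2 r' h
      exact ⟨⟨hN.1, this.1, by rw [insAll_minLeaf n r hTr r' h]; exact hN.2.2⟩,
        hM.1, hM.2.1, this.2⟩

/-- delete the leaf `n` (which must be a right child) -/
def del (n : ℕ) : CTree → CTree
  | leaf m => leaf m
  | node c l r => if r = leaf n then l else node c (del n l) (del n r)

theorem del_self (n : ℕ) (T : CTree) (h : n ∉ leavesList T) : del n T = T := by
  induction T with
  | leaf m => rfl
  | node c l r hl hr =>
    simp only [leavesList, List.mem_append, not_or] at h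
    have : r ≠ leaf n := by rintro rfl; simp [leavesList] at h
    simp [del, this, hl h.1, hr h.2]

theorem del_ins (n : ℕ) (T : CTree) (h : n ∉ leavesList T) : ∀ T' ∈ insAll n T, del n T' = T := by
  induction T with
  | leaf m => simp [insAll, del]
  | node c l r hl hr =>
    simp only [leavesList, List.mem_append, not_or] at h
    intro T' hT
    simp only [insAll, List.mem_cons, List.mem_append, List.mem_map] at hT
    rcases hT with rfl | ⟨l', hT, rfl⟩ | ⟨r', hT, rfl⟩
    · simp [del]
    · have : r ≠ leaf n := by rintro rfl; simp [leavesList] at h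
      simp [del, this, hl h.1 l' hT, del_self n r h.2]
    · have : r' ≠ leaf n := by
        rintro rfl
        have := insAll_isLeaf n r _ hT
        simp [isLeafB] at this
      simp [del, this, hr h.2 r' hT, del_self n l h.1]

theorem insAll_nodup (n : ℕ) (T : CTree) (h : n ∉ leavesList T) : (insAll n T).Nodup := by
  induction T with
  | leaf m => simp [insAll]
  | node c l r hl hr =>
    simp only [leavesList, List.mem_append, not_or] at h
    simp only [insAll, List.nodup_cons, List.mem_append, List.mem_map, not_or, not_exists, not_and,
      List.nodup_append]
    refine ⟨⟨?_, ?_⟩, ?_, ?_, ?_⟩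
    · intro l' _ he
      simp only [node.injEq] at he
      rw [he.2.2] at h
      simp [leavesList] at h
    · intro r' _ he
      simp only [node.injEq] at he
      have := congrArg sizeOf he.2.1
      simp at this
      omega
    · exact (hl h.1).map (fun a b hab => by simpa using hab)
    · exact (hr h.2).map (fun a b hab => by simpa using hab)
    · rintro _ ⟨l', hl', rfl⟩ _ ⟨r', hr', rfl⟩ he
      simp only [node.injEq] at he
      apply h.2
      rw [he.2.2]
      exact (insAll_perm n r r' hr').symm.subset (by simp)

theorem exists_ins (n : ℕ) (T : CTree) (hmem : n ∈ leavesList T)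
    (hle : ∀ x ∈ leavesList T, x ≤ n) (hnd : (leavesList T).Nodup) (hN : Normalized T)
    (hM : Mono T) (hne : T ≠ leaf n) :
    ∃ T₀, Normalized T₀ ∧ Mono T₀ ∧ T ∈ insAll n T₀ := by
  induction T with
  | leaf m =>
    simp only [leavesList, List.mem_singleton] at hmem
    subst hmem
    exact absurd rfl hne
  | node c l r hl hr =>
    simp only [leavesList, List.mem_append] at hmem hle
    simp only [leavesList, List.nodup_append] at hnd
    obtain ⟨hc, hMl, hMr⟩ := hM
    obtain ⟨hNl, hNr, hlt⟩ := hN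
    subst hc
    have hmr : minLeaf r ≤ n := hle _ (Or.inr (minLeaf_mem r))
    have key : ∀ S S₀, (∀ x ∈ leavesList S, x ≤ n) → (leavesList S).Nodup → S ∈ insAll n S₀ →
        minLeaf S₀ = minLeaf S := by
      intro S S₀ h1 h2 h3
      have hp := insAll_perm n S₀ S h3
      have h4 := hp.nodup_iff.1 h2
      refine (insAll_minLeaf n S₀ ?_ S h3).symm
      intro x hx
      have := h1 x (hp.symm.subset (by simp [hx]))
      have hx' : x ≠ n := by rintro rfl; simp [hx] at h4
      omega
    by_cases hr0 : r = leaf n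
    · subst hr0
      refine ⟨l, hNl, hMl, ?_⟩
      rw [insAll_eq]; simp
    rcases hmem with h | h
    · have hl0 : l ≠ leaf n := by
        rintro rfl
        simp only [minLeaf] at hlt
        omega
      obtain ⟨l₀, a, b, d⟩ := hl h (fun x hx => hle x (Or.inl hx)) hnd.1 hNl hMl hl0
      refine ⟨node 0 l₀ r, ⟨a, hNr, ?_⟩, ⟨rfl, b, hMr⟩, ?_⟩
      · rw [key l l₀ (fun x hx => hle x (Or.inl hx)) hnd.1 d]; exact hlt
      · rw [insAll_eq]
        simp only [insIn, List.mem_cons, List.mem_append, List.mem_map]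
        exact Or.inr (Or.inl ⟨l, d, rfl⟩)
    · obtain ⟨r₀, a, b, d⟩ := hr h (fun x hx => hle x (Or.inr hx)) hnd.2.1 hNr hMr hr0
      refine ⟨node 0 l r₀, ⟨hNl, a, ?_⟩, ⟨rfl, hMl, b⟩, ?_⟩
      · rw [key r r₀ (fun x hx => hle x (Or.inr hx)) hnd.2.1 d]; exact hlt
      · rw [insAll_eq]
        simp only [insIn, List.mem_cons, List.mem_append, List.mem_map]
        exact Or.inr (Or.inr ⟨r, d, rfl⟩)

/-- list of all normalized trees on `[m+1]` -/
def NorL : ℕ → List CTree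
  | 0 => [leaf 1]
  | m + 1 => (NorL m).flatMap (insAll (m + 2))

theorem onSet_iff_succ (m : ℕ) (T T₀ : CTree)
    (h : (leavesList T).Perm ((m + 1) :: leavesList T₀)) : OnSet (m + 1) T ↔ OnSet m T₀ := by
  have e : ((List.range (m + 1)).map (· + 1)).Perm ((m + 1) :: (List.range m).map (· + 1)) := by
    rw [List.range_succ, List.map_append]
    exact List.perm_append_singleton _ _
  unfold OnSet
  constructor
  · intro h'
    exact ((h.symm.trans h').trans e).cons_inv
  · intro h'
    exact h.trans ((h'.cons _).trans e.symm)

theorem onSet_mem {m : ℕ} {T : CTree} (h : OnSet m T) (x : ℕ) :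
    x ∈ leavesList T ↔ 1 ≤ x ∧ x ≤ m := by
  rw [h.mem_iff]
  simp only [List.mem_map, List.mem_range]
  constructor
  · rintro ⟨a, h, rfl⟩; omega
  · rintro h; exact ⟨x - 1, by omega, by omega⟩

theorem onSet_nodup {m : ℕ} {T : CTree} (h : OnSet m T) : (leavesList T).Nodup := by
  rw [h.nodup_iff]
  exact List.nodup_range.map (fun a b hab => by simpa using hab)

theorem mem_NorL (m : ℕ) : ∀ T, T ∈ NorL m ↔ T ∈ NorSet (m + 1) := by
  induction m with
  | zero =>
    intro T
    simp only [NorL, List.mem_singleton, NorSet, Set.mem_ofPred_eq]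
    constructor
    · rintro rfl
      simp [OnSet, leavesList, Normalized, Mono]
    · rintro ⟨h, hN, -⟩
      cases T with
      | leaf a =>
        have := (onSet_mem h a).1 (by simp [leavesList])
        congr 1; omega
      | node c l r =>
        have h1 := (onSet_mem h (minLeaf l)).1 (by simp [leavesList, minLeaf_mem])
        have h2 := (onSet_mem h (minLeaf r)).1 (by simp [leavesList, minLeaf_mem])
        have := hN.2.2
        omega
  | succ m ih =>
    intro T
    simp only [NorL, List.mem_flatMap, ih]
    constructor
    · rintro ⟨T₀, ⟨h1, h2, h3⟩, h⟩
      have hlt : ∀ x ∈ leavesList T₀, x < m + 2 := by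
        intro x hx
        have := (onSet_mem h1 x).1 hx
        omega
      have := insAll_norm _ T₀ hlt h2 h3 T h
      exact ⟨(onSet_iff_succ _ T T₀ (insAll_perm _ T₀ T h)).2 h1, this.1, this.2⟩
    · rintro ⟨h1, h2, h3⟩
      obtain ⟨T₀, a, b, d⟩ := exists_ins (m + 2) T ((onSet_mem h1 _).2 (by omega))
        (fun x hx => ((onSet_mem h1 x).1 hx).2) (onSet_nodup h1) h2 h3 (by
          rintro rfl
          have := (onSet_mem h1 1).2 (by omega)
          simp [leavesList] at this)
      exact ⟨T₀, ⟨(onSet_iff_succ _ T T₀ (insAll_perm _ T₀ T d)).1 h1, a, b⟩, d⟩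

theorem flatMap_nodup {α β : Type} (L : List α) (f : α → List β) (g : β → α) (hL : L.Nodup)
    (hf : ∀ x ∈ L, (f x).Nodup) (hg : ∀ x ∈ L, ∀ y ∈ f x, g y = x) : (L.flatMap f).Nodup := by
  rw [List.nodup_flatMap]
  refine ⟨hf, ?_⟩
  refine List.Pairwise.imp_of_mem ?_ hL
  intro a b ha hb hab y hya hyb
  exact hab ((hg a ha y hya).symm.trans (hg b hb y hyb))

theorem NorL_nodup (m : ℕ) : (NorL m).Nodup := by
  induction m with
  | zero => simp [NorL]
  | succ m ih =>
    have : ∀ T ∈ NorL m, m + 2 ∉ leavesList T := by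
      intro T hT h
      have := (onSet_mem ((mem_NorL m T).1 hT).1 _).1 h
      omega
    exact flatMap_nodup _ _ (del (m + 2)) ih (fun T hT => insAll_nodup _ T (this T hT))
      (fun T hT => del_ins _ T (this T hT))

theorem finsum_list {α M : Type} [AddCommMonoid M] (s : Set α) (L : List α) (hL : L.Nodup)
    (h : ∀ x, x ∈ L ↔ x ∈ s) (f : α → M) : (∑ᶠ x ∈ s, f x) = (L.map f).sum := by
  classical
  rw [← List.sum_toFinset f hL]
  have : s = ↑L.toFinset := by ext x; simp [h]
  rw [this, finsum_mem_coe_finset]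

theorem flatMap_sum {α β M : Type} [AddCommMonoid M] (L : List α) (f : α → List β) (F : β → M) :
    ((L.flatMap f).map F).sum = (L.map (fun x => ((f x).map F).sum)).sum := by
  induction L with
  | nil => simp
  | cons a L ih => simp [ih]

theorem tree_sum {M : Type} [AddCommMonoid M] (t : CTree → Multiset ℕ) (h0 : t (leaf 1) = 0)
    (ht : ∀ (n : ℕ) (T : CTree), (∀ x ∈ leavesList T, x < n) → ∀ F : Multiset ℕ → M,
      ((insAll n T).map (fun T' => F (t T'))).sum = Phi F (t T)) (m : ℕ) :
    ∀ F : Multiset ℕ → M, (∑ᶠ T ∈ NorSet (m + 1), F (t T)) = Psi m F := by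
  intro F
  rw [finsum_list _ (NorL m) (NorL_nodup m) (mem_NorL m)]
  induction m generalizing F with
  | zero => simp [NorL, Psi, h0]
  | succ m ih =>
    rw [NorL, flatMap_sum, Psi, ← ih]
    apply map_sum_congr
    intro T hT
    apply ht
    intro x hx
    have := (onSet_mem ((mem_NorL m T).1 hT).1 _).1 hx
    omega

/-! ### Block representations of chains -/

/-- `P` is a set partition of `A` such that `R` relates consecutive elements of the blocks -/
def Rep (A : Finset ℕ) (R : ℕ → ℕ → Prop) (P : Finset (Finset ℕ)) : Prop :=
  (∀ B ∈ P, B.Nonempty) ∧ (∀ a, a ∈ A ↔ ∃ B ∈ P, a ∈ B) ∧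
  (∀ B ∈ P, ∀ B' ∈ P, ∀ a ∈ B, a ∈ B' → B = B') ∧
  (∀ x y, R x y ↔ ∃ B ∈ P, x ∈ B ∧ y ∈ B ∧ x < y ∧ ∀ z ∈ B, z ≤ x ∨ y ≤ z)

theorem rep_conn {A : Finset ℕ} {R : ℕ → ℕ → Prop} {P : Finset (Finset ℕ)} (h : Rep A R P)
    {B : Finset ℕ} (hB : B ∈ P) {x : ℕ} (hx : x ∈ B) :
    ∀ y ∈ B, x < y → Relation.EqvGen R x y := by
  intro y
  induction y using Nat.strong_induction_on with
  | _ y ih =>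
    intro hy hxy
    have hne : (B.filter (· < y)).Nonempty := ⟨x, by simp [hx, hxy]⟩
    obtain ⟨z, hz, hmax⟩ := Finset.exists_max_image _ id hne
    simp only [Finset.mem_filter, id] at hz hmax
    have hR : R z y := by
      rw [h.2.2.2]
      refine ⟨B, hB, hz.1, hy, hz.2, ?_⟩
      intro t ht
      by_contra hc
      push Not at hc
      have := hmax t ⟨ht, hc.2⟩
      omega
    rcases Nat.lt_or_ge x z with h1 | h1
    · exact (ih z hz.2 hz.1 h1).trans _ _ _ (Relation.EqvGen.rel _ _ hR)
    · have := hmax x ⟨hx, hxy⟩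
      have : x = z := by omega
      subst this
      exact Relation.EqvGen.rel _ _ hR

theorem rep_eqv {A : Finset ℕ} {R : ℕ → ℕ → Prop} {P : Finset (Finset ℕ)} (h : Rep A R P)
    (x y : ℕ) (hxy : Relation.EqvGen R x y) : x = y ∨ ∃ B ∈ P, x ∈ B ∧ y ∈ B := by
  induction hxy with
  | rel x y hr =>
    obtain ⟨B, hB, h1, h2, -⟩ := (h.2.2.2 x y).1 hr
    exact Or.inr ⟨B, hB, h1, h2⟩
  | refl x => exact Or.inl rfl
  | symm x y _ ih =>
    rcases ih with rfl | ⟨B, hB, h1, h2⟩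
    · exact Or.inl rfl
    · exact Or.inr ⟨B, hB, h2, h1⟩
  | trans x y z _ _ ih1 ih2 =>
    rcases ih1 with rfl | ⟨B, hB, h1, h2⟩
    · exact ih2
    · rcases ih2 with rfl | ⟨B', hB', h1', h2'⟩
      · exact Or.inr ⟨B, hB, h1, h2⟩
      · have := h.2.2.1 B hB B' hB' y h2 h1'
        subst this
        exact Or.inr ⟨B, hB, h1, h2'⟩

theorem rep_type {A : Finset ℕ} {R : ℕ → ℕ → Prop} {P : Finset (Finset ℕ)} (h : Rep A R P) :
    chainType A R = P.val.map Finset.card := by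
  classical
  have key : ∀ B ∈ P, ∀ a ∈ B, (A.filter fun b => Relation.EqvGen R a b) = B := by
    intro B hB a ha
    ext b
    simp only [Finset.mem_filter]
    constructor
    · rintro ⟨-, hb⟩
      rcases rep_eqv h a b hb with rfl | ⟨B', hB', h1, h2⟩
      · exact ha
      · rwa [h.2.2.1 B hB B' hB' a ha h1]
    · intro hb
      refine ⟨(h.2.1 b).2 ⟨B, hB, hb⟩, ?_⟩
      rcases lt_trichotomy a b with h1 | h1 | h1
      · exact rep_conn h hB ha b hb h1
      · subst h1; exact Relation.EqvGen.refl _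
      · exact (rep_conn h hB hb a ha h1).symm
  have : (A.image fun a => A.filter fun b => Relation.EqvGen R a b) = P := by
    ext B
    simp only [Finset.mem_image]
    constructor
    · rintro ⟨a, ha, rfl⟩
      obtain ⟨B, hB, haB⟩ := (h.2.1 a).1 ha
      rw [key B hB a haB]
      exact hB
    · intro hB
      obtain ⟨a, ha⟩ := h.1 B hB
      exact ⟨a, (h.2.1 a).2 ⟨B, hB, ha⟩, key B hB a ha⟩
  unfold chainType
  rw [← this]

theorem rep_iso {A A' : Finset ℕ} {R R' : ℕ → ℕ → Prop} {P : Finset (Finset ℕ)} {M : ℕ}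
    (h : Rep A R P) (hM : ∀ a ∈ A, a < M) (hA : ∀ a, a ∈ A' ↔ a = M ∨ a ∈ A)
    (hR : ∀ x y, R' x y ↔ R x y) :
    ∃ P', Rep A' R' P' ∧ P'.val.map Finset.card = P.val.map Finset.card + {1} := by
  have hMP : ∀ B ∈ P, ∀ x ∈ B, x < M := fun B hB x hx => hM x ((h.2.1 x).2 ⟨B, hB, hx⟩)
  have hnot : ({M} : Finset ℕ) ∉ P := by
    intro hc
    have := hMP _ hc M (by simp)
    omega
  refine ⟨insert {M} P, ⟨?_, ?_, ?_, ?_⟩, ?_⟩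
  · intro B hB
    rw [Finset.mem_insert] at hB
    rcases hB with rfl | hB
    · simp
    · exact h.1 B hB
  · intro a
    rw [hA, h.2.1]
    simp
  · intro B hB B' hB' a ha ha'
    rw [Finset.mem_insert] at hB hB'
    rcases hB with rfl | hB <;> rcases hB' with rfl | hB'
    · rfl
    · simp only [Finset.mem_singleton] at ha
      subst ha
      have := hMP _ hB' _ ha'
      omega
    · simp only [Finset.mem_singleton] at ha'
      subst ha'
      have := hMP _ hB _ ha
      omega
    · exact h.2.2.1 B hB B' hB' a ha ha'
  · intro x y
    rw [hR, h.2.2.2]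
    constructor
    · rintro ⟨B, hB, hh⟩
      exact ⟨B, by simp [hB], hh⟩
    · rintro ⟨B, hB, hh⟩
      rw [Finset.mem_insert] at hB
      rcases hB with rfl | hB
      · simp only [Finset.mem_singleton] at hh
        omega
      · exact ⟨B, hB, hh⟩
  · rw [Finset.insert_val_of_notMem hnot]
    rw [Multiset.map_cons, Finset.card_singleton, ← Multiset.singleton_add, add_comm]

theorem rep_att {A A' : Finset ℕ} {R R' : ℕ → ℕ → Prop} {P : Finset (Finset ℕ)} {M : ℕ}
    (h : Rep A R P) (hM : ∀ a ∈ A, a < M) (hA : ∀ a, a ∈ A' ↔ a = M ∨ a ∈ A)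
    {B : Finset ℕ} (hB : B ∈ P) {a : ℕ} (ha : a ∈ B)
    (hR : ∀ x y, R' x y ↔ (x = a ∧ y = M) ∨ (x ≠ a ∧ R x y)) :
    ∃ P', Rep A' R' P' ∧ P'.val.map Finset.card =
      (P.val.map Finset.card).erase B.card + cl (B.card - 1 - (B.filter (· < a)).card) +
        {(B.filter (· < a)).card + 2} := by
  have hMP : ∀ B ∈ P, ∀ x ∈ B, x < M := fun B hB x hx => hM x ((h.2.1 x).2 ⟨B, hB, hx⟩)
  have hMB := hMP B hB
  obtain ⟨B1, hB1⟩ : ∃ B1, B1 = insert M (B.filter (· ≤ a)) := ⟨_, rfl⟩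
  obtain ⟨B2, hB2⟩ : ∃ B2, B2 = B.filter (a < ·) := ⟨_, rfl⟩
  have m1 : ∀ x, x ∈ B1 ↔ x = M ∨ (x ∈ B ∧ x ≤ a) := by intro x; simp [hB1]
  have m2 : ∀ x, x ∈ B2 ↔ (x ∈ B ∧ a < x) := by intro x; simp [hB2]
  have mP : ∀ C, C ∈ (insert B1 (insert B2 (P.erase B))).erase ∅ ↔
      C ≠ ∅ ∧ (C = B1 ∨ C = B2 ∨ (C ≠ B ∧ C ∈ P)) := by intro C; simp
  have haM := hMB a ha
  have hlt : (B.filter (· ≤ a)).card = (B.filter (· < a)).card + 1 := by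
    have : B.filter (· ≤ a) = insert a (B.filter (· < a)) := by
      ext x; simp only [Finset.mem_filter, Finset.mem_insert]
      constructor
      · rintro ⟨h1, h2⟩
        rcases Nat.lt_or_ge x a with h3 | h3
        · exact Or.inr ⟨h1, h3⟩
        · left; omega
      · rintro (rfl | ⟨h1, h2⟩)
        · exact ⟨ha, le_rfl⟩
        · exact ⟨h1, h2.le⟩
    rw [this, Finset.card_insert_of_notMem (by simp)]
  have c1 : B1.card = (B.filter (· < a)).card + 2 := by
    rw [hB1, Finset.card_insert_of_notMem, hlt]
    intro hc
    have := hMB M (Finset.mem_filter.1 hc).1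
    omega
  have c2 : B2.card = B.card - 1 - (B.filter (· < a)).card := by
    have := Finset.card_filter_add_card_filter_not (s := B) (· ≤ a)
    simp only [not_le] at this
    rw [hB2]
    omega
  have n1 : B1 ≠ ∅ := by
    intro hc
    have := (m1 M).2 (Or.inl rfl)
    simp [hc] at this
  have n1P : B1 ∉ P := by
    intro hc
    have := hMP _ hc M ((m1 M).2 (Or.inl rfl))
    omega
  have n12 : B1 ≠ B2 := by
    intro hc
    have := (m1 M).2 (Or.inl rfl)
    rw [hc, m2] at this
    have := hMB M this.1
    omega
  have n2P : B2 ∉ P := by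
    intro hc
    obtain ⟨x, hx⟩ := h.1 _ hc
    have := h.2.2.1 B hB B2 hc x ((m2 x).1 hx).1 hx
    rw [this, m2] at ha
    omega
  have n0P : ∅ ∉ P := by
    intro hc
    have := h.1 _ hc
    simp at this
  refine ⟨(insert B1 (insert B2 (P.erase B))).erase ∅, ⟨?_, ?_, ?_, ?_⟩, ?_⟩
  · intro C hC
    rw [mP] at hC
    exact Finset.nonempty_iff_ne_empty.2 hC.1
  · intro x
    rw [hA, h.2.1]
    constructor
    · rintro (rfl | ⟨C, hC, hx⟩)
      · exact ⟨B1, (mP _).2 ⟨n1, Or.inl rfl⟩, (m1 _).2 (Or.inl rfl)⟩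
      · by_cases hCB : C = B
        · subst hCB
          rcases Nat.lt_or_ge a x with h1 | h1
          · have hx2 := (m2 x).2 ⟨hx, h1⟩
            exact ⟨B2, (mP _).2 ⟨Finset.nonempty_iff_ne_empty.1 ⟨x, hx2⟩, by simp⟩, hx2⟩
          · exact ⟨B1, (mP _).2 ⟨n1, by simp⟩, (m1 x).2 (Or.inr ⟨hx, h1⟩)⟩
        · exact ⟨C, (mP _).2 ⟨Finset.nonempty_iff_ne_empty.1 ⟨x, hx⟩, by simp [hCB, hC]⟩, hx⟩
    · rintro ⟨C, hC, hx⟩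
      rw [mP] at hC
      rcases hC with ⟨-, rfl | rfl | hC⟩
      · rcases (m1 x).1 hx with rfl | hx
        · simp
        · exact Or.inr ⟨B, hB, hx.1⟩
      · exact Or.inr ⟨B, hB, ((m2 x).1 hx).1⟩
      · exact Or.inr ⟨C, hC.2, hx⟩
  · intro C hC D hD x hxC hxD
    rw [mP] at hC hD
    have dP : ∀ D ∈ P, D ≠ B → x ∈ D → x ∈ B → False := by
      intro D hD hne h1 h2
      exact hne (h.2.2.1 D hD B hB x h1 h2)
    have dM : ∀ D ∈ P, x ∈ D → x ≠ M := by
      rintro D hD hx rfl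
      have := hMP D hD _ hx
      omega
    have dM := fun D hD => dM D hD
    rcases hC with ⟨-, rfl | rfl | hC⟩ <;> rcases hD with ⟨-, rfl | rfl | hD⟩
    · rfl
    · rw [m1] at hxC; rw [m2] at hxD
      have := hMB x hxD.1
      omega
    · rw [m1] at hxC
      rcases hxC with h1 | h1
      · exact absurd h1 (dM D hD.2 hxD)
      · exact (dP D hD.2 hD.1 hxD h1.1).elim
    · rw [m2] at hxC; rw [m1] at hxD
      have := hMB x hxC.1
      omega
    · rfl
    · exact (dP D hD.2 hD.1 hxD ((m2 x).1 hxC).1).elim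
    · rw [m1] at hxD
      rcases hxD with h1 | h1
      · exact absurd h1 (dM C hC.2 hxC)
      · exact (dP C hC.2 hC.1 hxC h1.1).elim
    · exact (dP C hC.2 hC.1 hxC ((m2 x).1 hxD).1).elim
    · exact h.2.2.1 C hC.2 D hD.2 x hxC hxD
  · intro x y
    rw [hR, h.2.2.2]
    constructor
    · rintro (⟨rfl, rfl⟩ | ⟨hxa, C, hC, hx, hy, hxy, hz⟩)
      · refine ⟨B1, (mP _).2 ⟨n1, by simp⟩, (m1 _).2 (Or.inr ⟨ha, le_rfl⟩),
          (m1 _).2 (Or.inl rfl), haM, ?_⟩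
        intro z hz
        rcases (m1 z).1 hz with h1 | h1
        · right; omega
        · left; omega
      · by_cases hCB : C = B
        · subst hCB
          rcases Nat.lt_or_ge a x with h1 | h1
          · have hx2 := (m2 x).2 ⟨hx, h1⟩
            refine ⟨B2, (mP _).2 ⟨Finset.nonempty_iff_ne_empty.1 ⟨x, hx2⟩, by simp⟩, hx2,
              (m2 y).2 ⟨hy, by omega⟩, hxy, ?_⟩
            intro z hz'
            exact hz z ((m2 z).1 hz').1
          · have hya : y ≤ a := by
              have := hz a ha
              omega
            refine ⟨B1, (mP _).2 ⟨n1, by simp⟩, (m1 x).2 (Or.inr ⟨hx, h1⟩),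
              (m1 y).2 (Or.inr ⟨hy, hya⟩), hxy, ?_⟩
            intro z hz'
            rcases (m1 z).1 hz' with h2 | h2
            · right; omega
            · exact hz z h2.1
        · exact ⟨C, (mP _).2 ⟨Finset.nonempty_iff_ne_empty.1 ⟨x, hx⟩, by simp [hCB, hC]⟩,
            hx, hy, hxy, hz⟩
    · rintro ⟨C, hC, hx, hy, hxy, hz⟩
      rw [mP] at hC
      rcases hC with ⟨-, rfl | rfl | hC⟩
      · rw [m1] at hx hy
        rcases hx with hx | hx
        · rcases hy with hy | hy
          · omega
          · have := hMB y hy.1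
            omega
        · rcases hy with hy | hy
          · left
            have := hz a ((m1 a).2 (Or.inr ⟨ha, le_rfl⟩))
            omega
          · right
            refine ⟨by omega, B, hB, hx.1, hy.1, hxy, ?_⟩
            intro z hzB
            rcases Nat.lt_or_ge a z with h1 | h1
            · right; omega
            · exact hz z ((m1 z).2 (Or.inr ⟨hzB, h1⟩))
      · rw [m2] at hx hy
        right
        refine ⟨by omega, B, hB, hx.1, hy.1, hxy, ?_⟩
        intro z hzB
        rcases Nat.lt_or_ge a z with h1 | h1
        · exact hz z ((m2 z).2 ⟨hzB, h1⟩)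
        · left; omega
      · right
        refine ⟨?_, C, hC.2, hx, hy, hxy, hz⟩
        rintro rfl
        exact hC.1 (h.2.2.1 C hC.2 B hB x hx ha)
  · have e1 : (P.erase B).val.map Finset.card = (P.val.map Finset.card).erase B.card := by
      have : P.val = B ::ₘ (P.erase B).val := by
        rw [Finset.erase_val]
        exact (Multiset.cons_erase hB).symm
      rw [this, Multiset.map_cons, Multiset.erase_cons_head]
    rw [← e1, ← c1, ← c2]
    by_cases h2 : B2 = ∅
    · have : (insert B1 (insert B2 (P.erase B))).erase ∅ = insert B1 (P.erase B) := by
        ext C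
        rw [mP]
        simp only [Finset.mem_insert, Finset.mem_erase]
        constructor
        · rintro ⟨h3, h4 | h4 | h4⟩
          · exact Or.inl h4
          · exact absurd (h4.trans h2) h3
          · exact Or.inr h4
        · rintro (h4 | h4)
          · exact ⟨by rw [h4]; exact n1, Or.inl h4⟩
          · refine ⟨?_, Or.inr (Or.inr h4)⟩
            rintro rfl
            exact n0P h4.2
      rw [this, Finset.insert_val_of_notMem (by simp [n1P]), Multiset.map_cons, h2]
      rw [← Multiset.singleton_add, add_comm]
      simp [cl]
    · rw [Finset.erase_eq_of_notMem (by
        simp only [Finset.mem_insert, Finset.mem_erase, not_or, not_and]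
        exact ⟨n1.symm, fun hc => h2 hc.symm, fun _ => n0P⟩),
        Finset.insert_val_of_notMem (by simp [n1P, n12]),
        Finset.insert_val_of_notMem (by simp [n2P]), cl_pos (by simpa using h2)]
      simp only [Multiset.map_cons]
      simp only [← Multiset.singleton_add]
      abel

theorem sum_rank {M : Type} [AddCommMonoid M] (g : ℕ → M) (B : Finset ℕ) :
    ∑ a ∈ B, g (B.filter (· < a)).card = ∑ i ∈ Finset.range B.card, g i := by
  induction B using Finset.induction_on_max with
  | empty => simp
  | insert b B hb ih =>
    have hnb : b ∉ B := fun h => lt_irrefl _ (hb b h)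
    rw [Finset.sum_insert hnb, Finset.card_insert_of_notMem hnb, Finset.sum_range_succ, ← ih,
      add_comm]
    congr 1
    · apply Finset.sum_congr rfl
      intro a ha
      congr 2
      rw [Finset.filter_insert, if_neg (hb a ha).not_gt]
    · congr 2
      rw [Finset.filter_insert, if_neg (lt_irrefl b)]
      exact Finset.filter_true_of_mem hb

/-- summing over all attachments gives the splitting sum -/
theorem rep_sum {M : Type} [AddCommMonoid M] {A : Finset ℕ} {R : ℕ → ℕ → Prop}
    {P : Finset (Finset ℕ)} (h : Rep A R P) (F : Multiset ℕ → M) (g : ℕ → M)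
    (hg : ∀ B ∈ P, ∀ a ∈ B, g a = F ((P.val.map Finset.card).erase B.card +
      cl (B.card - 1 - (B.filter (· < a)).card) + {(B.filter (· < a)).card + 2})) :
    ∑ a ∈ A, g a = S F (P.val.map Finset.card) := by
  have hA : A = P.biUnion id := by ext a; simp [h.2.1]
  rw [hA, Finset.sum_biUnion]
  · unfold S
    rw [Multiset.map_map]
    change _ = ∑ B ∈ P, _
    apply Finset.sum_congr rfl
    intro B hB
    simp only [id, Function.comp]
    rw [← sum_rank (fun i => F ((P.val.map Finset.card).erase B.card +
      cl (B.card - 1 - i) + {i + 2}))]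
    exact Finset.sum_congr rfl (hg B hB)
  · intro B hB B' hB' hne
    simp only [Function.onFun, id]
    rw [Finset.disjoint_left]
    intro a h1 h2
    exact hne (h.2.2.1 B hB B' hB' a h1 h2)

theorem rep_card {A : Finset ℕ} {R : ℕ → ℕ → Prop}
    {P : Finset (Finset ℕ)} (h : Rep A R P) : (P.val.map Finset.card).sum = A.card := by
  have hA : A = P.biUnion id := by ext a; simp [h.2.1]
  rw [hA, Finset.card_biUnion]
  · rfl
  · intro B hB B' hB' hne
    simp only [Function.onFun, id]
    rw [Finset.disjoint_left]
    intro a h1 h2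
    exact hne (h.2.2.1 B hB B' hB' a h1 h2)

/-! ### Words -/

theorem exists_split_at (w : List ℕ) (i x y : ℕ) (hx : w[i]? = some x) (hy : w[i + 1]? = some y) :
    w = w.take i ++ x :: y :: w.drop (i + 2) ∧ w.take (i + 1) = w.take i ++ [x] ∧
      w.take (i + 2) = w.take i ++ [x, y] := by
  obtain ⟨h1, rfl⟩ := List.getElem?_eq_some_iff.1 hx
  obtain ⟨h2, rfl⟩ := List.getElem?_eq_some_iff.1 hy
  have e1 : w.take (i + 1) = w.take i ++ [w[i]] := by simp
  have e2 : w.take (i + 2) = w.take i ++ [w[i], w[i + 1]] := by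
    have e3 : w.take (i + 1 + 1) = w.take (i + 1) ++ [w[i + 1]] := by simp
    rw [show i + 2 = (i + 1) + 1 from rfl, e3, e1, List.append_assoc]
    rfl
  refine ⟨?_, e1, e2⟩
  conv_lhs => rw [← List.take_append_drop (i + 2) w, e2]
  simp

theorem AA_iff (w : List ℕ) (x y : ℕ) : AApair w x y ↔ x < y ∧ ∃ s t,
    w = s ++ x :: y :: t ∧ s.count x = 1 ∧ s.count y = 0 := by
  constructor
  · rintro ⟨hlt, i, h1, h2, h3, h4⟩
    obtain ⟨e, e1, -⟩ := exists_split_at w i x y h1 h2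
    refine ⟨hlt, _, _, e, ?_, ?_⟩
    · rw [e1] at h3; simpa using h3
    · rw [e1] at h4
      have : x ≠ y := by omega
      simpa [this] using h4
  · rintro ⟨hlt, s, t, rfl, h3, h4⟩
    have hne : x ≠ y := by omega
    refine ⟨hlt, s.length, by simp, by simp, ?_, ?_⟩
    · simp [List.take_append, h3, List.take_of_length_le]
    · simp [List.take_append, h4, hne, List.take_of_length_le]

theorem TN_iff (w : List ℕ) (x y : ℕ) : TNpair w x y ↔ x < y ∧ ∃ s t,
    w = s ++ y :: x :: t ∧ s.count y = 1 ∧ s.count x = 1 := by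
  constructor
  · rintro ⟨hlt, i, h1, h2, h3, h4⟩
    obtain ⟨e, e1, e2⟩ := exists_split_at w i y x h1 h2
    refine ⟨hlt, _, _, e, ?_, ?_⟩
    · rw [e1] at h3; simpa using h3
    · rw [e2] at h4
      have : y ≠ x := by omega
      simpa [this] using h4
  · rintro ⟨hlt, s, t, rfl, h3, h4⟩
    have hne : y ≠ x := by omega
    refine ⟨hlt, s.length, by simp, by simp, ?_, ?_⟩
    · simp [List.take_append, h3, List.take_of_length_le]
    · simp [List.take_append, h4, hne, List.take_of_length_le]

theorem split1 (s t u v : List ℕ) (x y : ℕ) : u ++ v = s ++ x :: y :: t ↔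
    (∃ t', u = s ++ x :: y :: t' ∧ t = t' ++ v) ∨ (u = s ++ [x] ∧ v = y :: t) ∨
    (∃ s', s = u ++ s' ∧ v = s' ++ x :: y :: t) := by
  constructor
  · intro h
    rw [List.append_eq_append_iff] at h
    rcases h with ⟨s', h1, h2⟩ | ⟨s', h1, h2⟩
    · exact Or.inr (Or.inr ⟨s', h1, h2⟩)
    · rcases s' with _ | ⟨a, _ | ⟨b, t'⟩⟩
      · exact Or.inr (Or.inr ⟨[], by simpa using h1.symm, by simpa using h2.symm⟩)
      · simp only [List.cons_append, List.nil_append, List.cons.injEq] at h2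
        right; left
        exact ⟨by rw [h1, h2.1], h2.2.symm⟩
      · simp only [List.cons_append, List.cons.injEq] at h2
        left
        exact ⟨t', by rw [h1, h2.1, h2.2.1], h2.2.2⟩
  · rintro (⟨t', rfl, rfl⟩ | ⟨rfl, rfl⟩ | ⟨s', rfl, rfl⟩) <;> simp

theorem split2 (s t u v : List ℕ) (x y M : ℕ) : u ++ M :: M :: v = s ++ x :: y :: t ↔
    (∃ t', u = s ++ x :: y :: t' ∧ t = t' ++ M :: M :: v) ∨
    (u = s ++ [x] ∧ y = M ∧ t = M :: v) ∨ (s = u ∧ x = M ∧ y = M ∧ v = t) ∨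
    (s = u ++ [M] ∧ x = M ∧ v = y :: t) ∨
    (∃ s', s = u ++ M :: M :: s' ∧ v = s' ++ x :: y :: t) := by
  rw [split1]
  constructor
  · rintro (h | ⟨h1, h2⟩ | ⟨s', h1, h2⟩)
    · exact Or.inl h
    · simp only [List.cons.injEq] at h2
      exact Or.inr (Or.inl ⟨h1, h2.1.symm, h2.2.symm⟩)
    · rcases s' with _ | ⟨a, _ | ⟨b, s'⟩⟩
      · simp only [List.nil_append, List.cons.injEq] at h2
        exact Or.inr (Or.inr (Or.inl ⟨by simpa using h1, h2.1.symm, h2.2.1.symm, h2.2.2⟩))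
      · simp only [List.cons_append, List.nil_append, List.cons.injEq] at h2
        refine Or.inr (Or.inr (Or.inr (Or.inl ⟨by rw [h1, h2.1], h2.2.1.symm, h2.2.2⟩)))
      · simp only [List.cons_append, List.cons.injEq] at h2
        refine Or.inr (Or.inr (Or.inr (Or.inr ⟨s', by rw [h1, ← h2.1, ← h2.2.1], h2.2.2⟩)))
  · rintro (h | ⟨h1, rfl, rfl⟩ | ⟨rfl, rfl, rfl, rfl⟩ | ⟨rfl, rfl, rfl⟩ | ⟨s', rfl, rfl⟩)
    · exact Or.inl h
    · exact Or.inr (Or.inl ⟨h1, rfl⟩)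
    · exact Or.inr (Or.inr ⟨[], by simp, by simp⟩)
    · exact Or.inr (Or.inr ⟨[x], by simp, by simp⟩)
    · exact Or.inr (Or.inr ⟨M :: M :: s', by simp, by simp⟩)

/-- effect of inserting `MM` on ascending adjacent pairs -/
theorem AA_ins (u v : List ℕ) (M : ℕ) (hM : ∀ x ∈ u ++ v, x < M) (x y : ℕ) :
    AApair (u ++ M :: M :: v) x y ↔
      (y = M ∧ ∃ s, u = s ++ [x] ∧ s.count x = 1) ∨
      ((¬ ∃ s, u = s ++ [x] ∧ s.count x = 1) ∧ AApair (u ++ v) x y) := by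
  have hMu : M ∉ u := fun h => lt_irrefl _ (hM M (by simp [h]))
  have hMv : M ∉ v := fun h => lt_irrefl _ (hM M (by simp [h]))
  rw [AA_iff, AA_iff]
  constructor
  · rintro ⟨hlt, s, t, h, c1, c2⟩
    rw [split2] at h
    rcases h with ⟨t', rfl, rfl⟩ | ⟨rfl, rfl, rfl⟩ | ⟨rfl, rfl, rfl, rfl⟩ | ⟨rfl, rfl, rfl⟩ |
      ⟨s', rfl, rfl⟩
    · right
      refine ⟨?_, hlt, s, t' ++ v, by simp, c1, c2⟩
      rintro ⟨s2, h, c⟩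
      have hs : s.count x + 1 ≤ s2.count x := by
        have h' := congrArg (List.count x) h
        have h'' := congrArg List.getLast? h
        have hne : y ≠ x := by omega
        rcases List.eq_nil_or_concat t' with rfl | ⟨t'', z, rfl⟩
        · simp [List.getLast?_append] at h''
          omega
        · have hz : z = x := by
            rw [List.concat_eq_append, show s ++ x :: y :: (t'' ++ [z]) =
              (s ++ x :: y :: t'') ++ [z] by simp, List.getLast?_concat,
              List.getLast?_concat] at h''
            exact Option.some.inj h''
          subst hz
          simp [List.count_append, List.count_cons] at h'
          omega
      omega
    · left; exact ⟨rfl, s, rfl, c1⟩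
    · omega
    · have := hM y (by simp)
      omega
    · right
      have hx : x < M := hM x (by simp)
      have hy : y < M := hM y (by simp)
      have hx' : M ≠ x := by omega
      have hy' : M ≠ y := by omega
      simp only [List.count_append, List.count_cons, beq_iff_eq, hx', hy', if_false, add_zero]
        at c1 c2
      refine ⟨?_, hlt, u ++ s', t, by simp, by simpa using c1, by simpa using c2⟩
      rintro ⟨s2, rfl, c⟩
      simp at c1
      omega
  · rintro (⟨rfl, s, rfl, c⟩ | ⟨hn, hlt, s, t, h, c1, c2⟩)
    · refine ⟨hM x (by simp), s, y :: v, by simp, c, ?_⟩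
      rw [List.count_eq_zero]
      intro h; exact hMu (by simp [h])
    · refine ⟨hlt, ?_⟩
      rw [split1] at h
      rcases h with ⟨t', rfl, rfl⟩ | ⟨rfl, rfl⟩ | ⟨s', rfl, rfl⟩
      · exact ⟨s, t' ++ M :: M :: v, by simp, c1, c2⟩
      · exact absurd ⟨s, rfl, c1⟩ hn
      · have hx : x < M := hM x (by simp)
        have hy : y < M := hM y (by simp)
        have hx' : M ≠ x := by omega
        have hy' : M ≠ y := by omega
        refine ⟨u ++ M :: M :: s', t, by simp, ?_, ?_⟩
        · simpa [hx'] using c1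
        · simpa [hy'] using c2

/-- effect of inserting `MM` on terminally nested pairs -/
theorem TN_ins (u v : List ℕ) (M : ℕ) (hM : ∀ x ∈ u ++ v, x < M)
    (h2 : ∀ x, (u ++ v).count x ≤ 2) (x y : ℕ) :
    TNpair (u ++ M :: M :: v) x y ↔
      (y = M ∧ ∃ t, v = x :: t ∧ u.count x = 1) ∨
      ((¬ ∃ t, v = x :: t ∧ u.count x = 1) ∧ TNpair (u ++ v) x y) := by
  have hMu : M ∉ u := fun h => lt_irrefl _ (hM M (by simp [h]))
  have hMv : M ∉ v := fun h => lt_irrefl _ (hM M (by simp [h]))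
  rw [TN_iff, TN_iff]
  constructor
  · rintro ⟨hlt, s, t, h, c1, c2⟩
    rw [split2] at h
    rcases h with ⟨t', rfl, rfl⟩ | ⟨rfl, rfl, rfl⟩ | ⟨rfl, rfl, rfl, rfl⟩ | ⟨rfl, rfl, rfl⟩ |
      ⟨s', rfl, rfl⟩
    · right
      refine ⟨?_, hlt, s, t' ++ v, by simp, c1, c2⟩
      rintro ⟨t2, rfl, c⟩
      have hne : y ≠ x := by omega
      simp [hne] at c
      omega
    · have := hM y (by simp)
      omega
    · omega
    · left
      have hx : x < y := hlt
      refine ⟨rfl, t, rfl, ?_⟩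
      have hne : y ≠ x := by omega
      simpa [hne] using c2
    · right
      have hx : x < M := hM x (by simp)
      have hy : y < M := hM y (by simp)
      have hx' : M ≠ x := by omega
      have hy' : M ≠ y := by omega
      simp only [List.count_append, List.count_cons, beq_iff_eq, hx', hy', if_false, add_zero]
        at c1 c2
      refine ⟨?_, hlt, u ++ s', t, by simp, by simpa using c1, by simpa using c2⟩
      rintro ⟨t2, h, c⟩
      rcases s' with _ | ⟨z, s'⟩
      · simp at h; omega
      · simp only [List.cons_append, List.cons.injEq] at h
        obtain ⟨rfl, -⟩ := h
        simp at c2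
        omega
  · rintro (⟨rfl, t, rfl, c⟩ | ⟨hn, hlt, s, t, h, c1, c2⟩)
    · have hx : x < y := hM x (by simp)
      refine ⟨hx, u ++ [y], t, by simp, ?_, ?_⟩
      · have := List.count_eq_zero.2 hMu
        simp [this]
      · have hne : y ≠ x := by omega
        simp [hne, c]
    · refine ⟨hlt, ?_⟩
      rw [split1] at h
      have hne : y ≠ x := by omega
      rcases h with ⟨t', rfl, rfl⟩ | ⟨rfl, rfl⟩ | ⟨s', rfl, rfl⟩
      · exact ⟨s, t' ++ M :: M :: v, by simp, c1, c2⟩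
      · exact absurd ⟨t, rfl, by simp [hne, c2]⟩ hn
      · have hx : x < M := hM x (by simp)
        have hy : y < M := hM y (by simp)
        have hx' : M ≠ x := by omega
        have hy' : M ≠ y := by omega
        refine ⟨u ++ M :: M :: s', t, by simp, ?_, ?_⟩
        · simpa [hy'] using c1
        · simpa [hx'] using c2

/-! ### Enumeration of Stirling permutations -/

theorem stir_iff (A : Finset ℕ) (w : List ℕ) : IsStirling A w ↔
    (∀ a, w.count a = if a ∈ A then 2 else 0) ∧
    ∀ a b, List.Sublist [a, b, a] w → a < b := by
  unfold IsStirling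
  refine and_congr_right fun _ => ?_
  constructor
  · intro h a b hs
    obtain ⟨f, hf⟩ := List.sublist_iff_exists_orderEmbedding_getElem?_eq.1 hs
    refine h a b (f 0) (f 1) (f 2) (f.lt_iff_lt.2 (by omega)) (f.lt_iff_lt.2 (by omega)) ?_ ?_ ?_
    · rw [← hf]; rfl
    · rw [← hf]; rfl
    · rw [← hf]; rfl
  · intro h a b i l j hil hlj hi hj hl
    apply h
    obtain ⟨hl1, hl2⟩ := List.getElem?_eq_some_iff.1 hl
    have e : w = w.take l ++ (b :: w.drop (l + 1)) := by
      conv_lhs => rw [← List.take_append_drop l w]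
      rw [List.drop_eq_getElem_cons hl1, hl2]
    rw [e]
    have m1 : a ∈ w.take l := by
      rw [List.mem_iff_getElem?]
      exact ⟨i, by rw [List.getElem?_take_of_lt hil]; exact hi⟩
    have m2 : a ∈ w.drop (l + 1) := by
      rw [List.mem_iff_getElem?]
      refine ⟨j - (l + 1), ?_⟩
      rw [List.getElem?_drop, show l + 1 + (j - (l + 1)) = j by omega]
      exact hj
    exact (List.singleton_sublist.2 m1).append ((List.singleton_sublist.2 m2).cons_cons b)

theorem stir_mem {m : ℕ} {w : List ℕ} (h : w ∈ QSet m) (x : ℕ) : x ∈ w ↔ 1 ≤ x ∧ x ≤ m := by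
  rw [← List.count_pos_iff, h.1 x]
  simp only [Finset.mem_Icc]
  split <;> simp_all

theorem stir_ins (m : ℕ) (u v : List ℕ) :
    u ++ (m + 1) :: (m + 1) :: v ∈ QSet (m + 1) ↔ u ++ v ∈ QSet m := by
  unfold QSet QSetA
  simp only [Set.mem_ofPred_eq]
  rw [stir_iff, stir_iff]
  constructor
  · rintro ⟨h1, h2⟩
    refine ⟨?_, ?_⟩
    · intro a
      have := h1 a
      by_cases ha : m + 1 = a
      · subst ha
        simp at this ⊢
        omega
      · have e : (a ∈ Finset.Icc 1 (m + 1)) ↔ a ∈ Finset.Icc 1 m := by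
          simp only [Finset.mem_Icc]; omega
        simp only [e] at this
        simpa [ha] using this
    · intro a b hs
      apply h2
      refine hs.trans (List.Sublist.append_left ?_ u)
      exact (List.sublist_cons_self _ _).trans (List.sublist_cons_self _ _)
  · rintro ⟨h1, h2⟩
    have hM : m + 1 ∉ u ++ v := by
      rw [← List.count_eq_zero, h1]; simp
    simp only [List.mem_append, not_or] at hM
    have hcnt : ∀ a, (u ++ (m + 1) :: (m + 1) :: v).count a =
        if a ∈ Finset.Icc 1 (m + 1) then 2 else 0 := by
      intro a
      have := h1 a
      by_cases ha : m + 1 = a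
      · subst ha
        simp at this ⊢
        omega
      · have e : (a ∈ Finset.Icc 1 (m + 1)) ↔ a ∈ Finset.Icc 1 m := by
          simp only [Finset.mem_Icc]; omega
        simp only [e]
        simpa [ha] using this
    refine ⟨hcnt, ?_⟩
    intro a b hs
    have hle : ∀ x ∈ u ++ (m + 1) :: (m + 1) :: v, x ≤ m + 1 := by
      intro x hx
      rw [← List.count_pos_iff, hcnt] at hx
      by_contra hc
      rw [if_neg (by simp only [Finset.mem_Icc]; omega)] at hx
      omega
    have ha := hle a (hs.subset (by simp))
    have hb := hle b (hs.subset (by simp))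
    have key : a ≠ b := by
      rintro rfl
      have := hs.count_le a
      rw [hcnt] at this
      simp at this
      split at this <;> omega
    by_cases ham : a = m + 1
    · exfalso
      subst ham
      have hf := hs.filter (fun x => x ≠ b)
      have hs' : List.Sublist [m + 1, b, m + 1] ((u ++ [m + 1]) ++ ([m + 1] ++ v)) := by
        simpa using hs
      rw [List.sublist_append_iff] at hs'
      obtain ⟨l1, l2, e, s1, s2⟩ := hs'
      rcases l1 with _ | ⟨x1, _ | ⟨x2, _ | ⟨x3, l1⟩⟩⟩
      · simp only [List.nil_append] at e
        subst e
        have := s2.count_le (m + 1)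
        have h0 := List.count_eq_zero.2 hM.2
        simp [h0, List.count_cons] at this
      · simp only [List.cons_append, List.nil_append, List.cons.injEq] at e
        obtain ⟨rfl, rfl⟩ := e
        simp only [List.singleton_append] at s2
        cases s2 with
        | cons _ s2 => exact hM.2 (s2.subset (by simp))
        | cons_cons _ s2 => exact key rfl
      · simp only [List.cons_append, List.nil_append, List.cons.injEq] at e
        obtain ⟨rfl, rfl, rfl⟩ := e
        have := s1.reverse
        simp only [List.reverse_cons, List.reverse_nil, List.nil_append, List.singleton_append,
          List.reverse_append, List.cons_append] at this
        cases this with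
        | cons _ s2 => exact hM.1 (by simpa using s2.subset (by simp : m + 1 ∈ [b, m + 1]))
        | cons_cons _ s2 => exact key rfl
      · simp only [List.cons_append, List.cons.injEq] at e
        obtain ⟨rfl, rfl, rfl, -⟩ := e
        have := s1.count_le (m + 1)
        have h0 := List.count_eq_zero.2 hM.1
        simp [h0, List.count_cons] at this
    · by_cases hbm : b = m + 1
      · omega
      · apply h2
        have hf := hs.filter (fun x => x ≠ m + 1)
        have fu : u.filter (fun x => x ≠ m + 1) = u :=
          List.filter_eq_self.2 (fun x hx => by
            simp only [ne_eq, decide_not, Bool.not_eq_true', decide_eq_false_iff_not]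
            rintro rfl; exact hM.1 hx)
        have fv : v.filter (fun x => x ≠ m + 1) = v :=
          List.filter_eq_self.2 (fun x hx => by
            simp only [ne_eq, decide_not, Bool.not_eq_true', decide_eq_false_iff_not]
            rintro rfl; exact hM.2 hx)
        rw [List.filter_append] at hf
        simp only [ne_eq, decide_not] at fu fv
        simpa [ham, hbm, fu, fv] using hf

theorem stir_exists (m : ℕ) (w : List ℕ) (h : w ∈ QSet (m + 1)) :
    ∃ u v, w = u ++ (m + 1) :: (m + 1) :: v := by
  have hmem := stir_mem h
  unfold QSet QSetA at h
  simp only [Set.mem_ofPred_eq] at h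
  rw [stir_iff] at h
  obtain ⟨h1, h2⟩ := h
  have hc := h1 (m + 1)
  simp only [Finset.mem_Icc] at hc
  rw [if_pos (by omega)] at hc
  have hin : m + 1 ∈ w := (hmem _).2 (by omega)
  obtain ⟨u, t, e, hu⟩ := List.eq_append_cons_of_mem hin
  have hct : t.count (m + 1) = 1 := by
    rw [e] at hc
    have := List.count_eq_zero.2 hu
    simp [this] at hc
    omega
  have ht : m + 1 ∈ t := by rw [← List.count_pos_iff]; omega
  obtain ⟨y, v, e', -⟩ := List.eq_append_cons_of_mem ht
  subst e'
  rcases y with _ | ⟨b, y⟩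
  · exact ⟨u, v, by simpa using e⟩
  · exfalso
    have hb : b ≤ m + 1 := ((hmem b).1 (by simp [e])).2
    have : m + 1 < b := by
      apply h2
      rw [e]
      refine List.Sublist.trans ?_ (List.sublist_append_right _ _)
      simp
    omega

/-- insertion of `MM` at position `p` -/
def insW (M : ℕ) (w : List ℕ) (p : ℕ) : List ℕ := w.take p ++ M :: M :: w.drop p

/-- list of all Stirling permutations on `[m]` -/
def QL : ℕ → List (List ℕ)
  | 0 => [[]]
  | m + 1 => (QL m).flatMap fun w => (List.range (w.length + 1)).map (insW (m + 1) w)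

theorem mem_QL (m : ℕ) : ∀ w, w ∈ QL m ↔ w ∈ QSet m := by
  induction m with
  | zero =>
    intro w
    simp only [QL, List.mem_singleton]
    constructor
    · rintro rfl
      refine ⟨by simp, by simp⟩
    · intro h
      rw [List.eq_nil_iff_forall_not_mem]
      intro a ha
      have := (stir_mem h a).1 ha
      omega
  | succ m ih =>
    intro w
    simp only [QL, List.mem_flatMap, List.mem_map, List.mem_range, ih]
    constructor
    · rintro ⟨w, hw, p, -, rfl⟩
      unfold insW
      rw [stir_ins, List.take_append_drop]
      exact hw
    · intro h
      obtain ⟨u, v, rfl⟩ := stir_exists m w h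
      refine ⟨u ++ v, (stir_ins m u v).1 h, u.length, by simp, ?_⟩
      simp [insW]

theorem QL_nodup (m : ℕ) : (QL m).Nodup := by
  induction m with
  | zero => simp [QL]
  | succ m ih =>
    have hn : ∀ w ∈ QL m, m + 1 ∉ w := by
      intro w hw h
      have := (stir_mem ((mem_QL m w).1 hw) _).1 h
      omega
    refine flatMap_nodup _ _ (fun w => w.filter (fun x => x ≠ m + 1)) ih ?_ ?_
    · intro w hw
      refine List.Nodup.map_on ?_ List.nodup_range
      intro p hp q hq h
      have key : ∀ p, p ∈ List.range (w.length + 1) → (insW (m + 1) w p).idxOf (m + 1) = p := by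
        intro p hp
        rw [List.mem_range] at hp
        have : m + 1 ∉ w.take p := fun h => hn w hw (List.mem_of_mem_take h)
        unfold insW
        rw [List.idxOf_append_of_notMem this]
        simp
        omega
      rw [← key p hp, ← key q hq, h]
    · intro w hw y hy
      simp only [List.mem_map] at hy
      obtain ⟨p, -, rfl⟩ := hy
      unfold insW
      rw [List.filter_append]
      simp only [ne_eq, not_true_eq_false, decide_false, Bool.false_eq_true, not_false_eq_true,
        List.filter_cons_of_neg]
      rw [← List.filter_append, List.take_append_drop]
      refine List.filter_eq_self.2 (fun x hx => ?_)
      simp only [decide_not, Bool.not_eq_true', decide_eq_false_iff_not]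
      rintro rfl
      exact hn w hw hx


/-! ### Summing over insertion positions in words -/

theorem occ_sum {M : Type} [AddCommMonoid M] (g : ℕ → M) (c : M) (w : List ℕ) :
    (∀ a, w.count a ≤ 2) →
    (∑ p ∈ Finset.range w.length,
      if (w.take (p + 1)).count (w.getD p 0) = 2 then g (w.getD p 0) else c) =
    ∑ a ∈ w.toFinset.filter (fun a => w.count a = 2), g a + w.toFinset.card • c := by
  induction w using List.reverseRecOn with
  | nil => intro _; simp
  | append_singleton w b ih =>
    intro h2
    have hw : ∀ a, w.count a ≤ 2 := by
      intro a
      have := h2 a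
      rw [List.count_append] at this
      omega
    have hb : w.count b ≤ 1 := by
      have := h2 b
      rw [List.count_append] at this
      simp at this
      omega
    rw [List.length_append, List.length_singleton, Finset.sum_range_succ]
    have e1 : (∑ p ∈ Finset.range w.length,
        if ((w ++ [b]).take (p + 1)).count ((w ++ [b]).getD p 0) = 2
          then g ((w ++ [b]).getD p 0) else c) =
        ∑ p ∈ Finset.range w.length,
          if (w.take (p + 1)).count (w.getD p 0) = 2 then g (w.getD p 0) else c := by
      apply Finset.sum_congr rfl
      intro p hp
      rw [Finset.mem_range] at hp
      rw [List.take_append_of_le_length (by omega), List.getD_append _ _ _ _ hp]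
    rw [e1, ih hw]
    have e2 : (w ++ [b]).getD w.length 0 = b := by simp
    have e3 : (w ++ [b]).take (w.length + 1) = w ++ [b] := List.take_of_length_le (by simp)
    rw [e2, e3, List.count_append, List.count_singleton_self]
    rcases Nat.lt_or_ge 0 (w.count b) with h0 | h0
    · have hc : w.count b = 1 := by omega
      have hbw : b ∈ w := List.count_pos_iff.1 h0
      have t1 : (w ++ [b]).toFinset = w.toFinset := by
        ext x; simp; rintro rfl; exact hbw
      have t2 : (w.toFinset.filter fun a => (w ++ [b]).count a = 2) =
          insert b (w.toFinset.filter fun a => w.count a = 2) := by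
        ext x
        simp only [Finset.mem_filter, Finset.mem_insert, List.mem_toFinset, List.count_append]
        by_cases hx : x = b
        · subst hx; simp [hbw, hc]
        · have : [b].count x = 0 := by
            rw [List.count_eq_zero]; simpa using hx
          simp [hx, this]
      rw [t1, t2, Finset.sum_insert (by simp [hc]), if_pos (by omega)]
      abel
    · have hc : w.count b = 0 := by omega
      have hbw : b ∉ w := List.count_eq_zero.1 hc
      have t1 : (w ++ [b]).toFinset = insert b w.toFinset := by
        ext x; simp
      have t2 : ((insert b w.toFinset).filter fun a => (w ++ [b]).count a = 2) =
          (w.toFinset.filter fun a => w.count a = 2) := by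
        ext x
        simp only [Finset.mem_filter, Finset.mem_insert, List.mem_toFinset, List.count_append]
        by_cases hx : x = b
        · subst hx; simp [hbw, hc]
        · have : [b].count x = 0 := by
            rw [List.count_eq_zero]; simpa using hx
          simp [hx, this]
      rw [t1, t2, Finset.card_insert_of_notMem (by simpa using hbw), if_neg (by omega), succ_nsmul]
      abel

/-- the insertion behaviour shared by both pair relations -/
structure WRel (R : List ℕ → ℕ → ℕ → Prop) (p0 : List ℕ → ℕ) (q : ℕ → ℕ) : Prop where
  nil : ∀ x y, ¬ R [] x y
  reindex : ∀ (M : Type) [AddCommMonoid M] (w : List ℕ) (f : ℕ → M),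
    ∑ p ∈ Finset.range (w.length + 1), f p = ∑ p ∈ Finset.range w.length, f (q p) + f (p0 w)
  iso : ∀ m, ∀ w ∈ QSet m, ∀ x y, R (insW (m + 1) w (p0 w)) x y ↔ R w x y
  att : ∀ m, ∀ w ∈ QSet m, ∀ p < w.length, (w.take (p + 1)).count (w.getD p 0) = 2 →
    ∀ x y, R (insW (m + 1) w (q p)) x y ↔
      (x = w.getD p 0 ∧ y = m + 1) ∨ (x ≠ w.getD p 0 ∧ R w x y)
  att' : ∀ m, ∀ w ∈ QSet m, ∀ p < w.length, (w.take (p + 1)).count (w.getD p 0) ≠ 2 →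
    ∀ x y, R (insW (m + 1) w (q p)) x y ↔ R w x y

theorem stir_count_le {m : ℕ} {w : List ℕ} (h : w ∈ QSet m) (a : ℕ) : w.count a ≤ 2 := by
  rw [h.1 a]; split <;> omega

theorem stir_lt {m : ℕ} {w : List ℕ} (h : w ∈ QSet m) (p : ℕ) :
    ∀ x ∈ w.take p ++ w.drop p, x < m + 1 := by
  intro x hx
  rw [List.take_append_drop] at hx
  have := (stir_mem h x).1 hx
  omega

theorem cut_at {w : List ℕ} {p : ℕ} (hp : p < w.length) :
    w.take (p + 1) = w.take p ++ [w.getD p 0] ∧ w.drop p = w.getD p 0 :: w.drop (p + 1) := by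
  have e : w.getD p 0 = w[p] := by simp [hp]
  rw [e]
  exact ⟨by simp, List.drop_eq_getElem_cons hp⟩

theorem AA_rel : WRel AApair (fun _ => 0) (fun p => p + 1) where
  nil := by rintro x y ⟨-, i, h, -⟩; simp at h
  reindex := fun M _ w f => Finset.sum_range_succ' f _
  iso := by
    intro m w hw x y
    unfold insW
    rw [AA_ins _ _ _ (stir_lt hw 0)]
    simp
  att := by
    intro m w hw p hp hc x y
    unfold insW
    rw [AA_ins _ _ _ (stir_lt hw (p + 1)), List.take_append_drop, (cut_at hp).1]
    rw [(cut_at hp).1] at hc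
    generalize w.getD p 0 = a at *
    have hk : (∃ s, w.take p ++ [a] = s ++ [x] ∧ s.count x = 1) ↔ x = a := by
      constructor
      · rintro ⟨s, h, -⟩
        have := List.append_inj_right' h rfl
        simpa using this.symm
      · rintro rfl
        refine ⟨_, rfl, ?_⟩
        simpa using hc
    rw [hk]
    tauto
  att' := by
    intro m w hw p hp hc x y
    unfold insW
    rw [AA_ins _ _ _ (stir_lt hw (p + 1)), List.take_append_drop, (cut_at hp).1]
    rw [(cut_at hp).1] at hc
    generalize w.getD p 0 = a at *
    have hk : ¬ (∃ s, w.take p ++ [a] = s ++ [x] ∧ s.count x = 1) := by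
      rintro ⟨s, h, h'⟩
      apply hc
      rw [h]
      have := List.append_inj_right' h rfl
      simp only [List.cons.injEq, and_true] at this
      subst this
      simp [h']
    simp only [hk, and_false, false_or, not_false_eq_true, true_and]

theorem TN_rel : WRel TNpair (fun w => w.length) (fun p => p) where
  nil := by rintro x y ⟨-, i, h, -⟩; simp at h
  reindex := fun M _ w f => Finset.sum_range_succ f _
  iso := by
    intro m w hw x y
    unfold insW
    rw [TN_ins _ _ _ (stir_lt hw _)
      (fun x => by rw [List.take_append_drop]; exact stir_count_le hw x)]
    simp
  att := by
    intro m w hw p hp hc x y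
    unfold insW
    rw [TN_ins _ _ _ (stir_lt hw p)
      (fun x => by rw [List.take_append_drop]; exact stir_count_le hw x),
      List.take_append_drop, (cut_at hp).2]
    rw [(cut_at hp).1] at hc
    generalize w.getD p 0 = a at *
    have hk : (∃ t, a :: w.drop (p + 1) = x :: t ∧ (w.take p).count x = 1) ↔ x = a := by
      constructor
      · rintro ⟨s, h, -⟩
        exact (List.cons.inj h).1.symm
      · rintro rfl
        refine ⟨_, rfl, ?_⟩
        simpa using hc
    rw [hk]
    tauto
  att' := by
    intro m w hw p hp hc x y
    unfold insW
    rw [TN_ins _ _ _ (stir_lt hw p)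
      (fun x => by rw [List.take_append_drop]; exact stir_count_le hw x),
      List.take_append_drop, (cut_at hp).2]
    rw [(cut_at hp).1] at hc
    generalize w.getD p 0 = a at *
    have hk : ¬ (∃ t, a :: w.drop (p + 1) = x :: t ∧ (w.take p).count x = 1) := by
      rintro ⟨s, h, h'⟩
      apply hc
      have := (List.cons.inj h).1
      subst this
      simp [h']
    simp only [hk, and_false, false_or, not_false_eq_true, true_and]

section WordStep

variable {R : List ℕ → ℕ → ℕ → Prop} {p0 : List ℕ → ℕ} {q : ℕ → ℕ}

open Classical in
/-- type after attaching a new maximum to `a` -/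
noncomputable def attType (P : Finset (Finset ℕ)) (a : ℕ) : Multiset ℕ :=
  if h : ∃ B ∈ P, a ∈ B then
    (P.val.map Finset.card).erase h.choose.card +
      cl (h.choose.card - 1 - (h.choose.filter (· < a)).card) +
        {(h.choose.filter (· < a)).card + 2}
  else 0

theorem attType_eq {A : Finset ℕ} {R : ℕ → ℕ → Prop} {P : Finset (Finset ℕ)} (h : Rep A R P)
    {B : Finset ℕ} (hB : B ∈ P) {a : ℕ} (ha : a ∈ B) :
    attType P a = (P.val.map Finset.card).erase B.card +
      cl (B.card - 1 - (B.filter (· < a)).card) + {(B.filter (· < a)).card + 2} := by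
  have hex : ∃ B ∈ P, a ∈ B := ⟨B, hB, ha⟩
  have e : hex.choose = B := h.2.2.1 _ hex.choose_spec.1 _ hB a hex.choose_spec.2 ha
  unfold attType
  rw [dif_pos hex, e]

theorem Icc_lt (m : ℕ) : ∀ a ∈ Finset.Icc 1 m, a < m + 1 := by
  intro a ha; rw [Finset.mem_Icc] at ha; omega

theorem Icc_mem (m : ℕ) (a : ℕ) : a ∈ Finset.Icc 1 (m + 1) ↔ a = m + 1 ∨ a ∈ Finset.Icc 1 m := by
  simp only [Finset.mem_Icc]; omega

theorem step_iso (H : WRel R p0 q) {m : ℕ} {w : List ℕ} (hw : w ∈ QSet m) {P : Finset (Finset ℕ)}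
    (h : Rep (Finset.Icc 1 m) (R w) P) :
    ∃ P', Rep (Finset.Icc 1 (m + 1)) (R (insW (m + 1) w (p0 w))) P' ∧
      P'.val.map Finset.card = P.val.map Finset.card + {1} :=
  rep_iso h (Icc_lt m) (Icc_mem m) (H.iso m w hw)

theorem step_att (H : WRel R p0 q) {m : ℕ} {w : List ℕ} (hw : w ∈ QSet m) {P : Finset (Finset ℕ)}
    (h : Rep (Finset.Icc 1 m) (R w) P) {p : ℕ} (hp : p < w.length) :
    ∃ P', Rep (Finset.Icc 1 (m + 1)) (R (insW (m + 1) w (q p))) P' ∧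
      P'.val.map Finset.card = if (w.take (p + 1)).count (w.getD p 0) = 2
        then attType P (w.getD p 0) else P.val.map Finset.card + {1} := by
  split_ifs with hc
  · have hmem : w.getD p 0 ∈ w := by
      have e : w.getD p 0 = w[p] := by simp [hp]
      rw [e]; exact List.getElem_mem hp
    have hA : w.getD p 0 ∈ Finset.Icc 1 m := Finset.mem_Icc.2 ((stir_mem hw _).1 hmem)
    obtain ⟨B, hB, ha⟩ := (h.2.1 _).1 hA
    rw [attType_eq h hB ha]
    exact rep_att h (Icc_lt m) (Icc_mem m) hB ha (H.att m w hw p hp hc)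
  · exact rep_iso h (Icc_lt m) (Icc_mem m) (H.att' m w hw p hp hc)

theorem step_sum (H : WRel R p0 q) {M : Type} [AddCommMonoid M] (F : Multiset ℕ → M)
    {m : ℕ} {w : List ℕ} (hw : w ∈ QSet m) {P : Finset (Finset ℕ)}
    (h : Rep (Finset.Icc 1 m) (R w) P) :
    ∑ p ∈ Finset.range (w.length + 1),
      F (chainType (Finset.Icc 1 (m + 1)) (R (insW (m + 1) w p))) =
    Phi F (chainType (Finset.Icc 1 m) (R w)) := by
  rw [H.reindex M w]
  have e0 : chainType (Finset.Icc 1 (m + 1)) (R (insW (m + 1) w (p0 w))) =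
      P.val.map Finset.card + {1} := by
    obtain ⟨P', h1, h2⟩ := step_iso H hw h
    rw [rep_type h1, h2]
  have e1 : (∑ p ∈ Finset.range w.length,
      F (chainType (Finset.Icc 1 (m + 1)) (R (insW (m + 1) w (q p))))) =
      ∑ p ∈ Finset.range w.length, if (w.take (p + 1)).count (w.getD p 0) = 2
        then F (attType P (w.getD p 0)) else F (P.val.map Finset.card + {1}) := by
    apply Finset.sum_congr rfl
    intro p hp
    obtain ⟨P', h1, h2⟩ := step_att H hw h (Finset.mem_range.1 hp)
    rw [rep_type h1, h2]
    split_ifs <;> rfl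
  rw [e0, e1, occ_sum (fun a => F (attType P a)) _ w (stir_count_le hw)]
  have t1 : w.toFinset = Finset.Icc 1 m := by
    ext x; rw [List.mem_toFinset, stir_mem hw, Finset.mem_Icc]
  have t2 : ((Finset.Icc 1 m).filter fun a => w.count a = 2) = Finset.Icc 1 m := by
    apply Finset.filter_true_of_mem
    intro a ha
    rw [hw.1 a, if_pos ha]
  rw [t1, t2, rep_sum h F _ (fun B hB a ha => by rw [attType_eq h hB ha]), rep_type h]
  unfold Phi
  rw [rep_card h, succ_nsmul, add_assoc]

theorem QL_rep (H : WRel R p0 q) (m : ℕ) :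
    ∀ w ∈ QL m, ∃ P, Rep (Finset.Icc 1 m) (R w) P := by
  induction m with
  | zero =>
    intro w hw
    simp only [QL, List.mem_singleton] at hw
    subst hw
    refine ⟨∅, by simp, by simp, by simp, ?_⟩
    intro x y
    simp [H.nil]
  | succ m ih =>
    intro w hw
    simp only [QL, List.mem_flatMap, List.mem_map, List.mem_range] at hw
    obtain ⟨w, hw, p, hp, rfl⟩ := hw
    obtain ⟨P, h⟩ := ih w hw
    have hq := (mem_QL m w).1 hw
    by_cases hpp : p = p0 w
    · obtain ⟨P', h', -⟩ := step_iso H hq h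
      exact ⟨P', hpp ▸ h'⟩
    · have hr := H.reindex ℕ w (fun i => if i = p then 1 else 0)
      rw [Finset.sum_ite_eq' (Finset.range (w.length + 1)) p (fun _ => 1), if_pos (by simpa using hp),
        if_neg (Ne.symm hpp), add_zero] at hr
      obtain ⟨i, hi, hne⟩ := Finset.exists_ne_zero_of_sum_ne_zero (by rw [← hr]; exact one_ne_zero)
      have hip : q i = p := by
        by_contra hc
        exact hne (if_neg hc)
      obtain ⟨P', h', -⟩ := step_att H hq h (Finset.mem_range.1 hi)
      exact ⟨P', hip ▸ h'⟩

theorem word_sum (H : WRel R p0 q) {M : Type} [AddCommMonoid M] (m : ℕ) :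
    ∀ F : Multiset ℕ → M,
      (∑ᶠ w ∈ QSet m, F (chainType (Finset.Icc 1 m) (R w))) = Psi m F := by
  intro F
  rw [finsum_list _ (QL m) (QL_nodup m) (mem_QL m)]
  induction m generalizing F with
  | zero => simp [QL, Psi, chainType]
  | succ m ih =>
    rw [QL, flatMap_sum, Psi, ← ih]
    apply map_sum_congr
    intro w hw
    obtain ⟨P, h⟩ := QL_rep H m w hw
    rw [← step_sum H F ((mem_QL m w).1 hw) h, List.map_map, Finset.sum_range]
    rw [← List.sum_ofFn, List.ofFn_eq_map, ← List.map_coe_finRange_eq_range, List.map_map]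
    rfl

end WordStep

end FourTypes

/-- The four sums
`Σ_{Υ ∈ Nor_n} e_{λ^{Lyn}(Υ)} = Σ_{θ ∈ Q_{n-1}} e_{λ^{AA}(θ)}
  = Σ_{θ ∈ Q_{n-1}} e_{λ^{TN}(θ)} = Σ_{Υ ∈ Nor_n} e_{λ^{Comb}(Υ)}`
are equal in `ℤ[x_1,…,x_k]`. -/
theorem four_type_sums_equal (n k : ℕ) (hn : 1 ≤ n) (hk : 1 ≤ k) :
    (∑ᶠ T ∈ NorSet n, eprod k (CTree.lynType T)) =
        (∑ᶠ w ∈ QSet (n - 1), eprod k (aaType (n - 1) w)) ∧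
      (∑ᶠ w ∈ QSet (n - 1), eprod k (aaType (n - 1) w)) =
        (∑ᶠ w ∈ QSet (n - 1), eprod k (tnType (n - 1) w)) ∧
      (∑ᶠ w ∈ QSet (n - 1), eprod k (tnType (n - 1) w)) =
        (∑ᶠ T ∈ NorSet n, eprod k (CTree.combType T)) := by
  obtain ⟨m, rfl⟩ : ∃ m, n = m + 1 := ⟨n - 1, by omega⟩
  have h1 := FourTypes.tree_sum CTree.lynType (by rfl)
    (fun n T hT F => FourTypes.lyn_ins n T hT F) m (eprod k)
  have h2 := FourTypes.tree_sum CTree.combType (by rfl)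
    (fun n T _ F => FourTypes.comb_ins n T F) m (eprod k)
  have h3 := FourTypes.word_sum FourTypes.AA_rel m (eprod k)
  have h4 := FourTypes.word_sum FourTypes.TN_rel m (eprod k)
  rw [Nat.add_sub_cancel]
  unfold aaType tnType
  exact ⟨h1.trans h3.symm, h3.trans h4.symm, h4.trans h2.symm⟩
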